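/- There exists a universal constant C > 0 with the following property. Let ω : ℝ³ × (0,∞) → ℝ³ and v : ℝ³ × (0,∞) → ℝ³ be time-dependent vector fields such that at each time t > 0 the spatial functions are Schwartz and satisfy the Biot–Savart relation −Δv(·,t) = ∇ × ω(·,t). Then sup_{t>0} ‖v(·,t)‖_{L³(ℝ³)} + sup_{t>0} ‖∇v(·,t)‖_{L^{3/2}(ℝ³)} ≤ C sup_{t>0} ‖∇ × ω(·,t)‖_{L¹(ℝ³)}. -/

import Mathlib

open MeasureTheory Real
open scoped ENNReal

noncomputable section

/-- Three-dimensional Euclidean space. -/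
abbrev E3 := EuclideanSpace ℝ (Fin 3)

/-- Partial derivative of a scalar function in the `i`-th coordinate direction. -/
def pd (i : Fin 3) (f : E3 → ℝ) (x : E3) : ℝ :=
  fderiv ℝ f x (EuclideanSpace.single i 1)

/-- Componentwise Laplacian of a (possibly vector-valued) function on `ℝ³`. -/
def lap {F : Type*} [NormedAddCommGroup F] [NormedSpace ℝ F] (f : E3 → F) (x : E3) : F :=
  ∑ i : Fin 3, fderiv ℝ (fun y => fderiv ℝ f y (EuclideanSpace.single i 1)) x
    (EuclideanSpace.single i 1)

/-- The curl `∇ × f` of a vector field on `ℝ³`. -/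
def curl (f : E3 → E3) (x : E3) : E3 :=
  (EuclideanSpace.equiv (Fin 3) ℝ).symm
    ![pd 1 (fun y => f y 2) x - pd 2 (fun y => f y 1) x,
      pd 2 (fun y => f y 0) x - pd 0 (fun y => f y 2) x,
      pd 0 (fun y => f y 1) x - pd 1 (fun y => f y 0) x]

/-- The dyadic Hardy–Littlewood maximal function on the line. -/
def dyadicMaximal (γ : ℝ → ℝ≥0∞) (t : ℝ) : ℝ≥0∞ :=
  ⨆ k : ℤ, (ENNReal.ofReal ((2 : ℝ) ^ k))⁻¹ * ∫⁻ y in Metric.closedBall t ((2 : ℝ) ^ k), γ y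

lemma measurable_setLIntegral_closedBall {γ : ℝ → ℝ≥0∞} (hγ : Measurable γ) (r : ℝ) :
    Measurable fun t => ∫⁻ y in Metric.closedBall t r, γ y := by
  have h : (fun t => ∫⁻ y in Metric.closedBall t r, γ y) =
      fun t => ∫⁻ y, {p : ℝ × ℝ | dist p.2 p.1 ≤ r}.indicator (fun p => γ p.2) (t, y) := by
    funext t
    rw [← lintegral_indicator Metric.isClosed_closedBall.measurableSet]
    rfl
  rw [h]
  refine Measurable.lintegral_prod_right' ?_
  refine Measurable.indicator (by fun_prop) ?_
  exact measurableSet_le (by fun_prop) (by fun_prop)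

lemma measurable_dyadicMaximal {γ : ℝ → ℝ≥0∞} (hγ : Measurable γ) :
    Measurable (dyadicMaximal γ) :=
  Measurable.iSup fun _ => (measurable_setLIntegral_closedBall hγ _).const_mul _

lemma setLIntegral_closedBall_le_dyadicMaximal (γ : ℝ → ℝ≥0∞) (t : ℝ) {r : ℝ} (hr : 0 < r) :
    ∫⁻ y in Metric.closedBall t r, γ y ≤ ENNReal.ofReal (2 * r) * dyadicMaximal γ t := by
  obtain ⟨k, hk1, hk2⟩ := exists_mem_Ioc_zpow hr (one_lt_two : (1 : ℝ) < 2)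
  have h2 : (0 : ℝ) < 2 ^ (k + 1) := by positivity
  calc ∫⁻ y in Metric.closedBall t r, γ y
      ≤ ∫⁻ y in Metric.closedBall t (2 ^ (k + 1)), γ y :=
        lintegral_mono_set (Metric.closedBall_subset_closedBall hk2)
    _ = ENNReal.ofReal (2 ^ (k + 1)) * ((ENNReal.ofReal ((2 : ℝ) ^ (k + 1)))⁻¹ *
          ∫⁻ y in Metric.closedBall t (2 ^ (k + 1)), γ y) := by
        rw [← mul_assoc, ENNReal.mul_inv_cancel (by simpa using h2) ENNReal.ofReal_ne_top, one_mul]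
    _ ≤ ENNReal.ofReal (2 * r) * dyadicMaximal γ t := by
        gcongr
        · rw [zpow_add_one₀ (by norm_num)]; linarith
        · exact le_iSup (fun k : ℤ => (ENNReal.ofReal ((2 : ℝ) ^ k))⁻¹ *
            ∫⁻ y in Metric.closedBall t ((2 : ℝ) ^ k), γ y) (k + 1)

lemma mul_volume_dyadicMaximal_le (g : ℝ → ℝ≥0∞) {lam : ℝ} (hlam : 0 < lam) :
    ENNReal.ofReal lam * volume {t | ENNReal.ofReal lam < dyadicMaximal g t} ≤
      10 * ∫⁻ y, g y := by
  by_cases htop : ∫⁻ y, g y = ⊤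
  · rw [htop]; simp
  set E := {t | ENNReal.ofReal lam < dyadicMaximal g t} with hE
  have hex : ∀ t ∈ E, ∃ k : ℤ, ENNReal.ofReal (lam * 2 ^ k) <
      ∫⁻ y in Metric.closedBall t ((2 : ℝ) ^ k), g y := by
    intro t ht
    obtain ⟨k, hk⟩ := lt_iSup_iff.1 (show ENNReal.ofReal lam < dyadicMaximal g t from ht)
    refine ⟨k, ?_⟩
    have h2 : (0 : ℝ) < 2 ^ k := by positivity
    rw [mul_comm, ← div_eq_mul_inv,
      ENNReal.lt_div_iff_mul_lt (Or.inl (by simpa using h2)) (Or.inl ENNReal.ofReal_ne_top)] at hk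
    rwa [ENNReal.ofReal_mul hlam.le]
  choose! k hk using hex
  obtain ⟨u, huE, hdisj, hcov⟩ := Vitali.exists_disjoint_subfamily_covering_enlargement_closedBall
    E (fun t => t) (fun t => (2 : ℝ) ^ k t) ((∫⁻ y, g y).toReal / lam) (by
      intro t ht
      rw [le_div_iff₀ hlam, mul_comm]
      have h1 := (hk t ht).le.trans (setLIntegral_le_lintegral _ _)
      exact (ENNReal.ofReal_le_iff_le_toReal htop).1 h1) 5 (by norm_num)
  have hcount : u.Countable := hdisj.countable_of_nonempty_interior (fun t _ => by
    refine ⟨t, ?_⟩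
    exact (Metric.ball_subset_interior_closedBall) (Metric.mem_ball_self (by positivity)))
  have hsub : E ⊆ ⋃ b ∈ u, Metric.closedBall b (5 * (2 : ℝ) ^ k b) := by
    intro t ht
    obtain ⟨b, hb, hs⟩ := hcov t ht
    exact Set.mem_biUnion hb (hs (Metric.mem_closedBall_self (by positivity)))
  calc ENNReal.ofReal lam * volume E
      ≤ ENNReal.ofReal lam * ∑' b : u, volume (Metric.closedBall (b : ℝ) (5 * (2 : ℝ) ^ k b)) := by
        gcongr
        exact (measure_mono hsub).trans (measure_biUnion_le _ hcount _)
    _ = ∑' b : u, 10 * ENNReal.ofReal (lam * (2 : ℝ) ^ k b) := by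
        rw [← ENNReal.tsum_mul_left]
        congr 1; funext b
        rw [Real.volume_closedBall, ← ENNReal.ofReal_mul hlam.le,
          show (10 : ℝ≥0∞) = ENNReal.ofReal 10 by simp, ← ENNReal.ofReal_mul (by norm_num)]
        congr 1; ring
    _ ≤ ∑' b : u, 10 * ∫⁻ y in Metric.closedBall (b : ℝ) ((2 : ℝ) ^ k b), g y := by
        gcongr with b
        exact (hk b (huE b.2)).le
    _ = 10 * ∫⁻ y in ⋃ b ∈ u, Metric.closedBall b ((2 : ℝ) ^ k b), g y := by
        rw [ENNReal.tsum_mul_left, lintegral_biUnion hcount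
          (fun _ _ => Metric.isClosed_closedBall.measurableSet) hdisj]
    _ ≤ 10 * ∫⁻ y, g y := by gcongr; exact Measure.restrict_le_self

lemma mul_volume_dyadicMaximal_le_truncated (g : ℝ → ℝ≥0∞) {lam : ℝ}
    (hlam : 0 < lam) :
    ENNReal.ofReal lam * volume {t | ENNReal.ofReal lam < dyadicMaximal g t} ≤
      20 * ∫⁻ y, {y | ENNReal.ofReal (lam / 4) < g y}.indicator g y := by
  set g' := {y | ENNReal.ofReal (lam / 4) < g y}.indicator g with hg'
  have hsub : {t | ENNReal.ofReal lam < dyadicMaximal g t} ⊆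
      {t | ENNReal.ofReal (lam / 2) < dyadicMaximal g' t} := by
    intro t ht
    by_contra hcon
    simp only [Set.mem_ofPred_eq, not_lt] at ht hcon
    refine absurd ht (not_lt.2 (iSup_le fun k => ?_))
    have h2 : (0 : ℝ) < 2 ^ k := by positivity
    have hk := (le_iSup (fun k : ℤ => (ENNReal.ofReal ((2 : ℝ) ^ k))⁻¹ *
            ∫⁻ y in Metric.closedBall t ((2 : ℝ) ^ k), g' y) k).trans hcon
    have hpt : ∀ y, g y ≤ ENNReal.ofReal (lam / 4) + g' y := by
      intro y
      by_cases hy : ENNReal.ofReal (lam / 4) < g y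
      · rw [hg', Set.indicator_of_mem (by exact hy)]; exact le_add_self
      · exact (not_lt.1 hy).trans le_self_add
    calc (ENNReal.ofReal ((2 : ℝ) ^ k))⁻¹ * ∫⁻ y in Metric.closedBall t ((2 : ℝ) ^ k), g y
        ≤ (ENNReal.ofReal ((2 : ℝ) ^ k))⁻¹ *
          ∫⁻ y in Metric.closedBall t ((2 : ℝ) ^ k), (ENNReal.ofReal (lam / 4) + g' y) := by
          gcongr with y; exact hpt y
      _ = (ENNReal.ofReal ((2 : ℝ) ^ k))⁻¹ * (ENNReal.ofReal (lam / 4) * ENNReal.ofReal (2 * 2 ^ k))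
          + (ENNReal.ofReal ((2 : ℝ) ^ k))⁻¹ *
            ∫⁻ y in Metric.closedBall t ((2 : ℝ) ^ k), g' y := by
          rw [lintegral_add_left measurable_const, setLIntegral_const, Real.volume_closedBall,
            mul_add]
      _ ≤ ENNReal.ofReal (lam / 2) + ENNReal.ofReal (lam / 2) := by
          refine add_le_add ?_ hk
          rw [← ENNReal.ofReal_inv_of_pos h2, ← ENNReal.ofReal_mul (by positivity),
            ← ENNReal.ofReal_mul (by positivity)]
          apply ENNReal.ofReal_le_ofReal
          field_simp; norm_num
      _ = ENNReal.ofReal lam := by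
          rw [← ENNReal.ofReal_add (by positivity) (by positivity)]; congr 1; ring
  have h := mul_volume_dyadicMaximal_le g' (half_pos hlam)
  calc ENNReal.ofReal lam * volume {t | ENNReal.ofReal lam < dyadicMaximal g t}
      ≤ 2 * (ENNReal.ofReal (lam / 2) *
          volume {t | ENNReal.ofReal (lam / 2) < dyadicMaximal g' t}) := by
        rw [← mul_assoc, show (2 : ℝ≥0∞) = ENNReal.ofReal 2 by simp,
          ← ENNReal.ofReal_mul (by norm_num), mul_div_cancel₀ _ (by norm_num)]
        gcongr
    _ ≤ 2 * (10 * ∫⁻ y, g' y) := by gcongr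
    _ = 20 * ∫⁻ y, g' y := by rw [← mul_assoc]; norm_num

lemma pow_three_le_lintegral_Ioi (a : ℝ≥0∞) :
    a ^ 3 ≤ ∫⁻ l in Set.Ioi (0 : ℝ), ENNReal.ofReal (3 * l ^ 2) *
      {l : ℝ | ENNReal.ofReal l < a}.indicator 1 l := by
  have key : ∀ b : ℝ, 0 ≤ b → ENNReal.ofReal b ≤ a → ENNReal.ofReal (b ^ 3) ≤
      ∫⁻ l in Set.Ioi (0 : ℝ), ENNReal.ofReal (3 * l ^ 2) *
        {l : ℝ | ENNReal.ofReal l < a}.indicator 1 l := by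
    intro b hb hba
    have h1 : ∫ l in (0 : ℝ)..b, 3 * l ^ 2 = b ^ 3 := by
      rw [intervalIntegral.integral_const_mul, integral_pow]; norm_num; ring
    rw [← h1, intervalIntegral.integral_of_le hb, integral_Ioc_eq_integral_Ioo,
      ofReal_integral_eq_lintegral_ofReal]
    · calc ∫⁻ l in Set.Ioo 0 b, ENNReal.ofReal (3 * l ^ 2)
          = ∫⁻ l in Set.Ioo 0 b, ENNReal.ofReal (3 * l ^ 2) *
            {l : ℝ | ENNReal.ofReal l < a}.indicator 1 l := by
            refine setLIntegral_congr_fun measurableSet_Ioo fun l hl => ?_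
            have : ENNReal.ofReal l < a :=
              ((ENNReal.ofReal_lt_ofReal_iff (hl.1.trans hl.2)).2 hl.2).trans_le hba
            simp [Set.indicator, this]
        _ ≤ _ := lintegral_mono_set Set.Ioo_subset_Ioi_self
    · exact (Continuous.integrableOn_Icc (by fun_prop)).mono_set Set.Ioo_subset_Icc_self
    · exact Filter.Eventually.of_forall fun l => by positivity
  rcases eq_or_ne a ⊤ with rfl | ha
  · refine le_of_eq_of_le (by simp) (le_of_eq (ENNReal.eq_top_of_forall_nnreal_le fun r => ?_).symm)
    have h := key (1 + r) (by positivity) le_top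
    refine le_trans ?_ h
    rw [← ENNReal.ofReal_coe_nnreal]
    apply ENNReal.ofReal_le_ofReal
    have hr : (0 : ℝ) ≤ r := r.2
    nlinarith [mul_nonneg hr hr, mul_nonneg (mul_nonneg hr hr) hr]
  · have h := key a.toReal ENNReal.toReal_nonneg (ENNReal.ofReal_toReal ha).le
    rwa [ENNReal.ofReal_pow ENNReal.toReal_nonneg, ENNReal.ofReal_toReal ha] at h

lemma lintegral_Ioi_indicator_le (a : ℝ≥0∞) :
    ∫⁻ l in Set.Ioi (0 : ℝ), ENNReal.ofReal l *
      {l : ℝ | ENNReal.ofReal (l / 4) < a}.indicator 1 l ≤ 16 * a ^ 2 := by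
  rcases eq_or_ne a ⊤ with rfl | ha
  · simp
  calc ∫⁻ l in Set.Ioi (0 : ℝ), ENNReal.ofReal l *
      {l : ℝ | ENNReal.ofReal (l / 4) < a}.indicator 1 l
      ≤ ∫⁻ l, (Set.Ioc 0 (4 * a.toReal)).indicator (fun _ => 4 * a) l := by
        rw [← lintegral_indicator measurableSet_Ioi]
        refine lintegral_mono fun l => ?_
        by_cases hl : 0 < l
        · by_cases hla : ENNReal.ofReal (l / 4) < a
          · have h4 := (ENNReal.ofReal_lt_iff_lt_toReal (by positivity) ha).1 hla
            have h5 : l ∈ Set.Ioc 0 (4 * a.toReal) := ⟨hl, by linarith⟩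
            have h6 : ENNReal.ofReal l ≤ 4 * a := by
              refine (ENNReal.ofReal_le_ofReal h5.2).trans ?_
              rw [ENNReal.ofReal_mul (by norm_num), ENNReal.ofReal_toReal ha,
                ENNReal.ofReal_ofNat]
            rw [Set.indicator_of_mem (by exact hl), Set.indicator_of_mem (by exact hla),
              Set.indicator_of_mem h5]
            simpa using h6
          · simp [Set.indicator, hla]
        · simp [Set.indicator, hl]
    _ = 16 * a ^ 2 := by
        rw [lintegral_indicator measurableSet_Ioc, setLIntegral_const, Real.volume_Ioc, sub_zero,
          ENNReal.ofReal_mul (by norm_num), ENNReal.ofReal_toReal ha, ENNReal.ofReal_ofNat]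
        ring

theorem lintegral_dyadicMaximal_pow_three_le {g : ℝ → ℝ≥0∞} (hg : Measurable g) :
    ∫⁻ t, dyadicMaximal g t ^ 3 ≤ 960 * ∫⁻ t, g t ^ 3 := by
  have hM := measurable_dyadicMaximal hg
  calc ∫⁻ t, dyadicMaximal g t ^ 3
      ≤ ∫⁻ t, ∫⁻ l in Set.Ioi (0 : ℝ), ENNReal.ofReal (3 * l ^ 2) *
          {l : ℝ | ENNReal.ofReal l < dyadicMaximal g t}.indicator 1 l :=
        lintegral_mono fun t => pow_three_le_lintegral_Ioi _
    _ = ∫⁻ l in Set.Ioi (0 : ℝ), ∫⁻ t, ENNReal.ofReal (3 * l ^ 2) *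
          {t : ℝ | ENNReal.ofReal l < dyadicMaximal g t}.indicator 1 t := by
        rw [lintegral_lintegral_swap]
        · rfl
        · refine Measurable.aemeasurable (Measurable.mul (by fun_prop) ?_)
          exact Measurable.indicator (f := fun _ : ℝ × ℝ => (1 : ℝ≥0∞)) measurable_const
            (s := {p : ℝ × ℝ | ENNReal.ofReal p.2 < dyadicMaximal g p.1})
            (measurableSet_lt (by fun_prop) (by fun_prop))
    _ ≤ ∫⁻ l in Set.Ioi (0 : ℝ), ∫⁻ t, 60 * (g t * (ENNReal.ofReal l *
          {l : ℝ | ENNReal.ofReal (l / 4) < g t}.indicator 1 l)) := by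
        refine setLIntegral_mono' measurableSet_Ioi fun l hl => ?_
        have hl : 0 < l := hl
        have hms : MeasurableSet {t : ℝ | ENNReal.ofReal l < dyadicMaximal g t} :=
          measurableSet_lt measurable_const hM
        have h := mul_volume_dyadicMaximal_le_truncated g hl
        have e : ∫⁻ t, 60 * (g t * (ENNReal.ofReal l *
          {l : ℝ | ENNReal.ofReal (l / 4) < g t}.indicator 1 l)) =
          60 * ENNReal.ofReal l * ∫⁻ y, {y | ENNReal.ofReal (l / 4) < g y}.indicator g y := by
          rw [← lintegral_const_mul _ (hg.indicator (measurableSet_lt measurable_const hg))]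
          congr 1; funext t
          by_cases ht : ENNReal.ofReal (l / 4) < g t
          · simp [Set.indicator, ht]; ring
          · simp [Set.indicator, ht]
        rw [e, lintegral_const_mul _ (measurable_one.indicator hms), lintegral_indicator_one hms,
          show 3 * l ^ 2 = 3 * l * l by ring, ENNReal.ofReal_mul (by positivity), mul_assoc,
          ENNReal.ofReal_mul (by norm_num), ENNReal.ofReal_ofNat]
        calc _ ≤ 3 * ENNReal.ofReal l *
              (20 * ∫⁻ y, {y | ENNReal.ofReal (l / 4) < g y}.indicator g y) := by gcongr
          _ = _ := by ring
    _ = ∫⁻ t, ∫⁻ l in Set.Ioi (0 : ℝ), 60 * (g t * (ENNReal.ofReal l *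
          {l : ℝ | ENNReal.ofReal (l / 4) < g t}.indicator 1 l)) := by
        rw [lintegral_lintegral_swap]
        refine Measurable.aemeasurable (Measurable.const_mul (Measurable.mul (by fun_prop)
          (Measurable.mul (by fun_prop) ?_)) _)
        exact Measurable.indicator (f := fun _ : ℝ × ℝ => (1 : ℝ≥0∞)) measurable_const
            (s := {p : ℝ × ℝ | ENNReal.ofReal (p.1 / 4) < g p.2})
            (measurableSet_lt (by fun_prop) (by fun_prop))
    _ ≤ ∫⁻ t, 60 * (g t * (16 * g t ^ 2)) := by
        refine lintegral_mono fun t => ?_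
        have hm : Measurable fun l : ℝ => ENNReal.ofReal l *
          {l : ℝ | ENNReal.ofReal (l / 4) < g t}.indicator 1 l :=
          Measurable.mul (by fun_prop) (measurable_one.indicator
            (measurableSet_lt (by fun_prop) measurable_const))
        rw [lintegral_const_mul _ (hm.const_mul _), lintegral_const_mul _ hm]
        gcongr
        exact lintegral_Ioi_indicator_le _
    _ = 960 * ∫⁻ t, g t ^ 3 := by
        rw [← lintegral_const_mul _ (by fun_prop)]
        congr 1; funext t; ring

/-- The sum of the geometric series that bounds the truncated kernel estimate. -/
def shellConst : ℝ≥0∞ :=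
  ∑' n : ℕ, ENNReal.ofReal (2 * (1 / 2 : ℝ) ^ (-(2 / 3) : ℝ) *
    ((1 / 2 : ℝ) ^ (-(2 / 3) : ℝ) * (1 / 2)) ^ n + 4 * (2 * (2 : ℝ) ^ (-(5 / 3) : ℝ)) ^ n)

lemma shellConst_ne_top : shellConst ≠ ⊤ := by
  refine Summable.tsum_ofReal_ne_top (Summable.add ?_ ?_)
  · refine (summable_geometric_of_lt_one (by positivity) ?_).mul_left _
    nth_rewrite 2 [show (1 / 2 : ℝ) = (1 / 2 : ℝ) ^ (1 : ℝ) by simp]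
    rw [← rpow_add (by norm_num)]
    exact rpow_lt_one (by norm_num) (by norm_num) (by norm_num)
  · refine (summable_geometric_of_lt_one (by positivity) ?_).mul_left _
    nth_rewrite 1 [show (2 : ℝ) = (2 : ℝ) ^ (1 : ℝ) by simp]
    rw [← rpow_add (by norm_num)]
    exact rpow_lt_one_of_one_lt_of_neg (by norm_num) (by norm_num)

lemma min_rpow_le_tsum (t s : ℝ) {a L h : ℝ} (ha : 0 ≤ a) (hL : 0 ≤ L) (hh : 0 < h) :
    min (ENNReal.ofReal (a * |s - t| ^ (-(2 / 3) : ℝ)))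
        (ENNReal.ofReal (L * |s - t| ^ (-(5 / 3) : ℝ))) ≤
      ∑' n : ℕ, ((Metric.closedBall t (h * (1 / 2) ^ n)).indicator
          (fun _ => ENNReal.ofReal (a * (h * (1 / 2) ^ (n + 1)) ^ (-(2 / 3) : ℝ))) s +
        (Metric.closedBall t (h * 2 ^ (n + 1))).indicator
          (fun _ => ENNReal.ofReal (L * (h * 2 ^ n) ^ (-(5 / 3) : ℝ))) s) := by
  rcases (abs_nonneg (s - t)).eq_or_lt' with h0 | h0
  · rw [h0, zero_rpow (by norm_num)]; simp
  rcases le_or_gt |s - t| h with h1 | h1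
  · obtain ⟨n, hn1, hn2⟩ := exists_nat_pow_near_of_lt_one (x := |s - t| / h) (y := (1 / 2 : ℝ))
      (by positivity) (by rwa [div_le_one hh]) (by norm_num) (by norm_num)
    rw [lt_div_iff₀ hh, mul_comm] at hn1
    rw [div_le_iff₀ hh, mul_comm] at hn2
    refine le_trans ?_ (ENNReal.le_tsum n)
    refine le_trans ?_ le_self_add
    rw [Set.indicator_of_mem (by rwa [Metric.mem_closedBall, Real.dist_eq])]
    refine (min_le_left _ _).trans (ENNReal.ofReal_le_ofReal ?_)
    gcongr 1
    exact rpow_le_rpow_of_nonpos (by positivity) hn1.le (by norm_num)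
  · obtain ⟨n, hn1, hn2⟩ := exists_nat_pow_near (x := |s - t| / h) (y := (2 : ℝ))
      (by rw [le_div_iff₀ hh]; linarith) (by norm_num)
    rw [le_div_iff₀ hh, mul_comm] at hn1
    rw [div_lt_iff₀ hh, mul_comm] at hn2
    refine le_trans ?_ (ENNReal.le_tsum n)
    refine le_trans ?_ le_add_self
    rw [Set.indicator_of_mem (by rw [Metric.mem_closedBall, Real.dist_eq]; exact hn2.le)]
    refine (min_le_right _ _).trans (ENNReal.ofReal_le_ofReal ?_)
    gcongr 1
    exact rpow_le_rpow_of_nonpos (by positivity) hn1 (by norm_num)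

lemma lintegral_mul_min_rpow_le {γ : ℝ → ℝ≥0∞} (hγ : Measurable γ) (t : ℝ) {a L : ℝ}
    (ha : 0 < a) (hL : 0 < L) :
    ∫⁻ s, γ s * min (ENNReal.ofReal (a * |s - t| ^ (-(2 / 3) : ℝ)))
        (ENNReal.ofReal (L * |s - t| ^ (-(5 / 3) : ℝ))) ≤
      shellConst * dyadicMaximal γ t * ENNReal.ofReal (a ^ (2 / 3 : ℝ) * L ^ (1 / 3 : ℝ)) := by
  set h := L / a with hdef
  have hh : 0 < h := by positivity
  have ind : ∀ (r : ℝ) (c : ℝ≥0∞), 0 < r →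
      ∫⁻ s, γ s * (Metric.closedBall t r).indicator (fun _ => c) s ≤
        ENNReal.ofReal (2 * r) * dyadicMaximal γ t * c := by
    intro r c hr
    calc ∫⁻ s, γ s * (Metric.closedBall t r).indicator (fun _ => c) s
        = (∫⁻ s in Metric.closedBall t r, γ s) * c := by
          rw [← lintegral_mul_const _ hγ,
            ← lintegral_indicator Metric.isClosed_closedBall.measurableSet]
          congr 1; funext s
          by_cases hs : s ∈ Metric.closedBall t r <;> simp [Set.indicator, hs]
      _ ≤ _ := by gcongr; exact setLIntegral_closedBall_le_dyadicMaximal γ t hr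
  have meas : ∀ (r : ℝ) (c : ℝ≥0∞), Measurable fun s =>
      (Metric.closedBall t r).indicator (fun _ => c) s := fun r c =>
    measurable_const.indicator Metric.isClosed_closedBall.measurableSet
  have e1 : a * h ^ (1 / 3 : ℝ) = a ^ (2 / 3 : ℝ) * L ^ (1 / 3 : ℝ) := by
    rw [hdef, div_rpow hL.le ha.le, mul_div_assoc', mul_comm a, mul_div_assoc, mul_comm]
    congr 1
    nth_rewrite 1 [← rpow_one a]
    rw [← rpow_sub ha]; norm_num
  have e2 : L * h ^ (-(2 / 3) : ℝ) = a ^ (2 / 3 : ℝ) * L ^ (1 / 3 : ℝ) := by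
    rw [← e1, hdef, rpow_neg (by positivity), div_rpow hL.le ha.le, div_rpow hL.le ha.le, inv_div]
    have h1 : a ^ (2 / 3 : ℝ) * a ^ (1 / 3 : ℝ) = a := by
      rw [← rpow_add ha]; norm_num
    have h2 : L ^ (2 / 3 : ℝ) * L ^ (1 / 3 : ℝ) = L := by
      rw [← rpow_add hL]; norm_num
    have h3 : 0 < L ^ (2 / 3 : ℝ) := by positivity
    have h4 : 0 < a ^ (1 / 3 : ℝ) := by positivity
    field_simp
    rw [mul_assoc, h1, mul_right_comm, h2, mul_comm]
  calc _ ≤ ∫⁻ s, γ s * ∑' n : ℕ, ((Metric.closedBall t (h * (1 / 2) ^ n)).indicator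
          (fun _ => ENNReal.ofReal (a * (h * (1 / 2) ^ (n + 1)) ^ (-(2 / 3) : ℝ))) s +
        (Metric.closedBall t (h * 2 ^ (n + 1))).indicator
          (fun _ => ENNReal.ofReal (L * (h * 2 ^ n) ^ (-(5 / 3) : ℝ))) s) := by
        gcongr with s
        exact min_rpow_le_tsum t s ha.le hL.le hh
    _ = ∑' n : ℕ, ((∫⁻ s, γ s * (Metric.closedBall t (h * (1 / 2) ^ n)).indicator
          (fun _ => ENNReal.ofReal (a * (h * (1 / 2) ^ (n + 1)) ^ (-(2 / 3) : ℝ))) s) +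
        ∫⁻ s, γ s * (Metric.closedBall t (h * 2 ^ (n + 1))).indicator
          (fun _ => ENNReal.ofReal (L * (h * 2 ^ n) ^ (-(5 / 3) : ℝ))) s) := by
        simp_rw [← ENNReal.tsum_mul_left, mul_add]
        rw [lintegral_tsum]
        swap
        · exact fun n => ((hγ.mul (meas _ _)).add (hγ.mul (meas _ _))).aemeasurable
        congr 1; funext n
        exact lintegral_add_left (hγ.mul (meas _ _)) _
    _ ≤ ∑' n : ℕ, (ENNReal.ofReal (2 * (h * (1 / 2) ^ n)) * dyadicMaximal γ t *
            ENNReal.ofReal (a * (h * (1 / 2) ^ (n + 1)) ^ (-(2 / 3) : ℝ)) +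
          ENNReal.ofReal (2 * (h * 2 ^ (n + 1))) * dyadicMaximal γ t *
            ENNReal.ofReal (L * (h * 2 ^ n) ^ (-(5 / 3) : ℝ))) := by
        gcongr with n
        · exact ind _ _ (by positivity)
        · exact ind _ _ (by positivity)
    _ = ∑' n : ℕ, ENNReal.ofReal (2 * (1 / 2 : ℝ) ^ (-(2 / 3) : ℝ) *
          ((1 / 2 : ℝ) ^ (-(2 / 3) : ℝ) * (1 / 2)) ^ n + 4 * (2 * (2 : ℝ) ^ (-(5 / 3) : ℝ)) ^ n) *
          (dyadicMaximal γ t * ENNReal.ofReal (a ^ (2 / 3 : ℝ) * L ^ (1 / 3 : ℝ))) := by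
        congr 1; funext n
        have f1 : 2 * (h * (1 / 2) ^ n) * (a * (h * (1 / 2) ^ (n + 1)) ^ (-(2 / 3) : ℝ)) =
            2 * (1 / 2 : ℝ) ^ (-(2 / 3) : ℝ) * ((1 / 2 : ℝ) ^ (-(2 / 3) : ℝ) * (1 / 2)) ^ n *
              (a ^ (2 / 3 : ℝ) * L ^ (1 / 3 : ℝ)) := by
          rw [← e1, show (1 / 3 : ℝ) = 1 + -(2 / 3) by norm_num, rpow_add hh, rpow_one,
            mul_rpow hh.le (by positivity), ← rpow_natCast (1 / 2) (n + 1), ← rpow_mul (by norm_num),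
            mul_comm ((n + 1 : ℕ) : ℝ), rpow_mul (by norm_num) _ ((n + 1 : ℕ) : ℝ), rpow_natCast]
          ring
        have f2 : 2 * (h * 2 ^ (n + 1)) * (L * (h * 2 ^ n) ^ (-(5 / 3) : ℝ)) =
            4 * (2 * (2 : ℝ) ^ (-(5 / 3) : ℝ)) ^ n * (a ^ (2 / 3 : ℝ) * L ^ (1 / 3 : ℝ)) := by
          rw [← e2, show (-(2 / 3) : ℝ) = 1 + -(5 / 3) by norm_num, rpow_add hh, rpow_one,
            mul_rpow hh.le (by positivity), ← rpow_natCast 2 n, ← rpow_mul (by norm_num),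
            mul_comm (n : ℝ), rpow_mul (by norm_num) _ (n : ℝ), rpow_natCast]
          ring
        have f3 : ∀ p q c d : ℝ, 0 ≤ p → 0 ≤ c → p * q = c * d →
            ENNReal.ofReal p * dyadicMaximal γ t * ENNReal.ofReal q =
              ENNReal.ofReal c * (dyadicMaximal γ t * ENNReal.ofReal d) := by
          intro p q c d hp hc e
          rw [mul_right_comm, ← ENNReal.ofReal_mul hp, e, ENNReal.ofReal_mul hc]
          ring
        rw [f3 _ _ _ _ (by positivity) (by positivity) f1,
          f3 _ _ _ _ (by positivity) (by positivity) f2,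
          ENNReal.ofReal_add (by positivity) (by positivity), add_mul]
    _ = _ := by rw [ENNReal.tsum_mul_right, shellConst, mul_assoc]

theorem lintegral_lintegral_mul_min_rpow_le {γ F : ℝ → ℝ≥0∞} (hγ : Measurable γ)
    (hF : Measurable F) {L : ℝ} (hL : 0 < L) (hFL : ∫⁻ t, F t ≤ ENNReal.ofReal L) :
    ∫⁻ t, ∫⁻ s, γ s * min (F t * ENNReal.ofReal (|s - t| ^ (-(2 / 3) : ℝ)))
        (ENNReal.ofReal (L * |s - t| ^ (-(5 / 3) : ℝ))) ≤
      shellConst * 960 ^ (1 / 3 : ℝ) * ENNReal.ofReal L * (∫⁻ s, γ s ^ 3) ^ (1 / 3 : ℝ) := by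
  have hfin : ∀ᵐ t, F t < ⊤ := ae_lt_top hF (ne_top_of_le_ne_top ENNReal.ofReal_ne_top hFL)
  calc ∫⁻ t, ∫⁻ s, γ s * min (F t * ENNReal.ofReal (|s - t| ^ (-(2 / 3) : ℝ)))
        (ENNReal.ofReal (L * |s - t| ^ (-(5 / 3) : ℝ)))
      ≤ ∫⁻ t, shellConst * ENNReal.ofReal (L ^ (1 / 3 : ℝ)) *
          (dyadicMaximal γ t * F t ^ (2 / 3 : ℝ)) := by
        refine lintegral_mono_ae ?_
        filter_upwards [hfin] with t ht
        rcases eq_or_ne (F t) 0 with h0 | h0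
        · simp [h0]
        have ha : 0 < (F t).toReal := ENNReal.toReal_pos h0 ht.ne
        have hofr : F t = ENNReal.ofReal (F t).toReal := (ENNReal.ofReal_toReal ht.ne).symm
        have h := lintegral_mul_min_rpow_le hγ t ha hL
        simp_rw [ENNReal.ofReal_mul ENNReal.toReal_nonneg] at h
        rw [ENNReal.ofReal_mul (by positivity),
          ← ENNReal.ofReal_rpow_of_nonneg ha.le (by norm_num), ← hofr] at h
        refine h.trans (le_of_eq ?_)
        ring
    _ ≤ shellConst * ENNReal.ofReal (L ^ (1 / 3 : ℝ)) *
          ((∫⁻ t, dyadicMaximal γ t ^ (3 : ℝ)) ^ (1 / 3 : ℝ) *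
            (∫⁻ t, (F t ^ (2 / 3 : ℝ)) ^ (3 / 2 : ℝ)) ^ (1 / (3 / 2) : ℝ)) := by
        have hM := measurable_dyadicMaximal hγ
        rw [lintegral_const_mul _ (by fun_prop)]
        gcongr
        exact ENNReal.lintegral_mul_le_Lp_mul_Lq volume
          (by rw [Real.holderConjugate_iff]; norm_num) hM.aemeasurable (by fun_prop)
    _ ≤ shellConst * ENNReal.ofReal (L ^ (1 / 3 : ℝ)) *
          ((960 * ∫⁻ t, γ t ^ 3) ^ (1 / 3 : ℝ) * ENNReal.ofReal L ^ (2 / 3 : ℝ)) := by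
        have h3 := lintegral_dyadicMaximal_pow_three_le hγ
        gcongr
        · exact_mod_cast h3
        · simp_rw [← ENNReal.rpow_mul]
          norm_num
          gcongr
    _ = _ := by
        rw [ENNReal.mul_rpow_of_nonneg _ _ (by norm_num : (0 : ℝ) ≤ 1 / 3),
          ENNReal.ofReal_rpow_of_nonneg hL.le (by norm_num)]
        nth_rewrite 3 [show L = L ^ (1 / 3 : ℝ) * L ^ (2 / 3 : ℝ) by
          rw [← rpow_add hL]; norm_num]
        rw [ENNReal.ofReal_mul (by positivity)]
        ring

/-- The integral of the Japanese bracket `(1 + ‖z‖ ^ 2) ^ (-q)` over the plane. -/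
def planarBracket (q : ℝ) : ℝ≥0∞ :=
  ∫⁻ z : Fin 2 → ℝ, ENNReal.ofReal ((1 + ‖z‖ ^ 2) ^ (-q))

lemma planarBracket_ne_top {q : ℝ} (hq : 1 < q) : planarBracket q ≠ ⊤ := by
  have h := integrable_rpow_neg_one_add_norm_sq (E := Fin 2 → ℝ) (μ := volume) (r := 2 * q)
    (by simp; linarith)
  have h2 := h.lintegral_lt_top
  rw [show -(2 * q) / 2 = -q by ring] at h2
  exact h2.ne

lemma lintegral_planarBracket_scaled {τ : ℝ} (hτ : τ ≠ 0) (q : ℝ) :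
    ∫⁻ z : Fin 2 → ℝ, ENNReal.ofReal ((τ ^ 2 + ‖z‖ ^ 2) ^ (-q)) =
      ENNReal.ofReal (|τ| ^ (2 - 2 * q)) * planarBracket q := by
  have ht : 0 < |τ| := abs_pos.2 hτ
  have hmeas : Measurable fun z : Fin 2 → ℝ => ENNReal.ofReal ((τ ^ 2 + ‖z‖ ^ 2) ^ (-q)) := by
    fun_prop
  have h := Measure.map_addHaar_smul (volume : Measure (Fin 2 → ℝ)) hτ
  have h1 := lintegral_map (μ := volume) hmeas (measurable_const_smul τ)
  rw [h, lintegral_smul_measure] at h1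
  have h2 : ∀ z : Fin 2 → ℝ, ENNReal.ofReal ((τ ^ 2 + ‖τ • z‖ ^ 2) ^ (-q)) =
      ENNReal.ofReal (|τ| ^ (-2 * q)) * ENNReal.ofReal ((1 + ‖z‖ ^ 2) ^ (-q)) := by
    intro z
    rw [← ENNReal.ofReal_mul (by positivity), norm_smul, Real.norm_eq_abs, mul_pow,
      show τ ^ 2 + |τ| ^ 2 * ‖z‖ ^ 2 = |τ| ^ 2 * (1 + ‖z‖ ^ 2) by rw [← sq_abs τ]; ring,
      mul_rpow (by positivity) (by positivity), ← rpow_natCast |τ| 2, ← rpow_mul ht.le]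
    norm_num
  simp_rw [h2] at h1
  rw [lintegral_const_mul _ (by fun_prop)] at h1
  have h3 : ENNReal.ofReal (|τ| ^ 2) * ENNReal.ofReal |(τ ^ Module.finrank ℝ (Fin 2 → ℝ))⁻¹| = 1 := by
    rw [← ENNReal.ofReal_mul (by positivity)]
    simp [hτ]
  calc _ = ENNReal.ofReal (|τ| ^ 2) * (ENNReal.ofReal |(τ ^ Module.finrank ℝ (Fin 2 → ℝ))⁻¹| *
        ∫⁻ z : Fin 2 → ℝ, ENNReal.ofReal ((τ ^ 2 + ‖z‖ ^ 2) ^ (-q))) := by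
        rw [← mul_assoc, h3, one_mul]
    _ = _ := by
        rw [smul_eq_mul] at h1
        rw [h1, ← mul_assoc, ← ENNReal.ofReal_mul (by positivity), ← rpow_natCast |τ| 2,
          ← rpow_add ht, planarBracket]
        congr 3
        push_cast; ring

lemma lintegral_mul_bracket_le {g : (Fin 2 → ℝ) → ℝ≥0∞} (hg : Measurable g) {τ : ℝ} (hτ : τ ≠ 0)
    (α : ℝ) (z : Fin 2 → ℝ) :
    ∫⁻ w, ENNReal.ofReal ((τ ^ 2 + ‖w - z‖ ^ 2) ^ (-α)) * g w ≤
      planarBracket (3 / 2 * α) ^ (2 / 3 : ℝ) * ENNReal.ofReal (|τ| ^ ((4 - 6 * α) / 3)) *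
        (∫⁻ w, g w ^ 3) ^ (1 / 3 : ℝ) := by
  have ht : 0 < |τ| := abs_pos.2 hτ
  have h := ENNReal.lintegral_mul_le_Lp_mul_Lq volume (p := 3 / 2) (q := 3)
    (by rw [Real.holderConjugate_iff]; norm_num)
    (f := fun w => ENNReal.ofReal ((τ ^ 2 + ‖w - z‖ ^ 2) ^ (-α))) (g := g) (by fun_prop)
    hg.aemeasurable
  refine h.trans (le_of_eq ?_)
  have h1 : ∀ w, ENNReal.ofReal ((τ ^ 2 + ‖w - z‖ ^ 2) ^ (-α)) ^ (3 / 2 : ℝ) =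
      ENNReal.ofReal ((τ ^ 2 + ‖w - z‖ ^ 2) ^ (-(3 / 2 * α))) := by
    intro w
    rw [ENNReal.ofReal_rpow_of_nonneg (by positivity) (by norm_num), ← rpow_mul (by positivity)]
    congr 2; ring
  simp_rw [h1]
  rw [lintegral_sub_right_eq_self
    (fun w => ENNReal.ofReal ((τ ^ 2 + ‖w‖ ^ 2) ^ (-(3 / 2 * α)))) z,
    lintegral_planarBracket_scaled hτ, ENNReal.mul_rpow_of_nonneg _ _ (by norm_num),
    ENNReal.ofReal_rpow_of_nonneg (by positivity) (by norm_num), ← rpow_mul ht.le,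
    mul_comm (ENNReal.ofReal _)]
  norm_num
  congr 4; ring

/-- The square of the distance to the origin, shifted by `ε ^ 2`. -/
def regSq (ε : ℝ) (x : E3) : ℝ := ‖x‖ ^ 2 + ε ^ 2

/-- The negative of the `j`-th derivative of the regularized Newtonian potential. -/
def regKernel (ε : ℝ) (j : Fin 3) (x : E3) : ℝ := x j * regSq ε x ^ (-(3 / 2) : ℝ)

/-- The derivative of `regKernel ε j` in the `k`-th direction. -/
def regKernelDeriv (ε : ℝ) (j k : Fin 3) (x : E3) : ℝ :=
  (if j = k then 1 else 0) * regSq ε x ^ (-(3 / 2) : ℝ) -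
    3 * (x j * x k) * regSq ε x ^ (-(5 / 2) : ℝ)

/-- The mollifier obtained as the Laplacian of the regularized Newtonian potential. -/
def regMollifier (ε : ℝ) (x : E3) : ℝ := 3 * ε ^ 2 * regSq ε x ^ (-(5 / 2) : ℝ)

section kernel

variable {ε : ℝ}

lemma regSq_pos (hε : 0 < ε) (x : E3) : 0 < regSq ε x := by unfold regSq; positivity

@[fun_prop]
lemma continuous_regSq : Continuous (regSq ε) := by unfold regSq; fun_prop

lemma continuous_regSq_rpow (hε : 0 < ε) (p : ℝ) : Continuous fun x => regSq ε x ^ p :=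
  continuous_regSq.rpow_const fun x => Or.inl (regSq_pos hε x).ne'

lemma continuous_regKernel (hε : 0 < ε) (j : Fin 3) : Continuous (regKernel ε j) :=
  (by fun_prop : Continuous fun x : E3 => x j).mul (continuous_regSq_rpow hε _)

lemma continuous_regKernelDeriv (hε : 0 < ε) (j k : Fin 3) : Continuous (regKernelDeriv ε j k) :=
  (continuous_const.mul (continuous_regSq_rpow hε _)).sub
    ((by fun_prop : Continuous fun x : E3 => 3 * (x j * x k)).mul (continuous_regSq_rpow hε _))

lemma continuous_regMollifier (hε : 0 < ε) : Continuous (regMollifier ε) :=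
  continuous_const.mul (continuous_regSq_rpow hε _)

lemma abs_coord_le_regSq (x : E3) (j : Fin 3) : |x j| ≤ regSq ε x ^ (1 / 2 : ℝ) := by
  rw [← Real.sqrt_eq_rpow]
  refine Real.le_sqrt_of_sq_le ?_
  have h := PiLp.norm_apply_le x j
  have : |x j| ^ 2 ≤ ‖x‖ ^ 2 := by gcongr; exact h
  unfold regSq
  nlinarith [sq_nonneg ε]

lemma abs_regKernel_le (hε : 0 < ε) (j : Fin 3) (x : E3) :
    |regKernel ε j x| ≤ regSq ε x ^ (-1 : ℝ) := by
  have hp := regSq_pos hε x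
  rw [regKernel, abs_mul, abs_of_pos (rpow_pos_of_pos hp _)]
  calc _ ≤ regSq ε x ^ (1 / 2 : ℝ) * regSq ε x ^ (-(3 / 2) : ℝ) := by
        gcongr; exact abs_coord_le_regSq x j
    _ = _ := by rw [← rpow_add hp]; norm_num

lemma abs_regKernelDeriv_le (hε : 0 < ε) (j k : Fin 3) (x : E3) :
    |regKernelDeriv ε j k x| ≤ 4 * regSq ε x ^ (-(3 / 2) : ℝ) := by
  have hp := regSq_pos hε x
  rw [regKernelDeriv]
  have h1 : |(if j = k then (1 : ℝ) else 0) * regSq ε x ^ (-(3 / 2) : ℝ)| ≤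
      regSq ε x ^ (-(3 / 2) : ℝ) := by
    rw [abs_mul, abs_of_pos (rpow_pos_of_pos hp _)]
    refine mul_le_of_le_one_left (by positivity) ?_
    split_ifs <;> simp
  have h2 : |3 * (x j * x k) * regSq ε x ^ (-(5 / 2) : ℝ)| ≤ 3 * regSq ε x ^ (-(3 / 2) : ℝ) := by
    rw [abs_mul, abs_mul, abs_mul, abs_of_pos (rpow_pos_of_pos hp _), abs_of_pos (by norm_num)]
    calc 3 * (|x j| * |x k|) * regSq ε x ^ (-(5 / 2) : ℝ)
        ≤ 3 * (regSq ε x ^ (1 / 2 : ℝ) * regSq ε x ^ (1 / 2 : ℝ)) *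
            regSq ε x ^ (-(5 / 2) : ℝ) := by
          gcongr <;> exact abs_coord_le_regSq x _
      _ = _ := by rw [← rpow_add hp, mul_assoc, ← rpow_add hp]; norm_num
  refine (abs_sub _ _).trans ?_
  linarith

lemma rpow_regSq_le (hε : 0 < ε) {p : ℝ} (hp : p ≤ 0) (x : E3) :
    regSq ε x ^ p ≤ (ε ^ 2) ^ p :=
  rpow_le_rpow_of_nonpos (by positivity) (by unfold regSq; linarith [sq_nonneg ‖x‖]) hp

lemma hasLineDerivAt_regSq_rpow (hε : 0 < ε) (p : ℝ) (x : E3) (k : Fin 3) :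
    HasLineDerivAt ℝ (fun x => regSq ε x ^ p) (2 * p * x k * regSq ε x ^ (p - 1)) x
      (EuclideanSpace.single k 1) := by
  have h1 : HasFDerivAt (fun x : E3 => ‖x‖ ^ 2 + ε ^ 2) (2 • innerSL ℝ x) x :=
    (hasStrictFDerivAt_norm_sq x).hasFDerivAt.add_const _
  have h2 := (h1.rpow_const (p := p) (Or.inl (regSq_pos hε x).ne')).hasLineDerivAt
    (EuclideanSpace.single k 1)
  have h3 : ((p * (‖x‖ ^ 2 + ε ^ 2) ^ (p - 1)) • (2 • innerSL ℝ x)) (EuclideanSpace.single k 1) =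
      2 * p * x k * regSq ε x ^ (p - 1) := by
    simp [regSq, EuclideanSpace.inner_single_right]
    ring
  rw [h3] at h2
  exact h2

lemma hasLineDerivAt_coord (x : E3) (j k : Fin 3) :
    HasLineDerivAt ℝ (fun x : E3 => x j) (if j = k then 1 else 0) x
      (EuclideanSpace.single k 1) := by
  have h := ((EuclideanSpace.proj (𝕜 := ℝ) j : E3 →L[ℝ] ℝ).hasFDerivAt (x := x)).hasLineDerivAt
    (EuclideanSpace.single k 1)
  have h1 : (EuclideanSpace.proj (𝕜 := ℝ) j : E3 →L[ℝ] ℝ) (EuclideanSpace.single k 1) =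
      if j = k then 1 else 0 := by
    simp
  rw [h1] at h
  exact h

lemma hasLineDerivAt_regKernel (hε : 0 < ε) (x : E3) (j k : Fin 3) :
    HasLineDerivAt ℝ (regKernel ε j) (regKernelDeriv ε j k x) x (EuclideanSpace.single k 1) := by
  have h1 := hasLineDerivAt_coord x j k
  have h2 := hasLineDerivAt_regSq_rpow hε (-(3 / 2)) x k
  unfold HasLineDerivAt at *
  have h := h1.fun_mul h2
  refine HasDerivAt.congr_deriv (f' := _) h ?_
  simp only [regKernelDeriv, zero_smul, add_zero]
  norm_num
  ring

lemma sum_regKernelDeriv (hε : 0 < ε) (x : E3) :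
    ∑ k, regKernelDeriv ε k k x = regMollifier ε x := by
  have hp := regSq_pos hε x
  have h1 : regSq ε x ^ (-(3 / 2) : ℝ) = regSq ε x * regSq ε x ^ (-(5 / 2) : ℝ) := by
    nth_rewrite 2 [← rpow_one (regSq ε x)]
    rw [← rpow_add hp]; norm_num
  have h2 : regSq ε x = x 0 ^ 2 + x 1 ^ 2 + x 2 ^ 2 + ε ^ 2 := by
    rw [regSq, EuclideanSpace.norm_sq_eq, Fin.sum_univ_three]
    simp
  simp only [regKernelDeriv, regMollifier, Fin.sum_univ_three, if_true]
  rw [h1]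
  generalize regSq ε x ^ (-(5 / 2) : ℝ) = q
  rw [h2]
  ring

end kernel

/-- The point of `ℝ³` with `i`-th coordinate `t` and remaining coordinates `z`. -/
def slicePt (i : Fin 3) (t : ℝ) (z : Fin 2 → ℝ) : E3 := WithLp.toLp 2 (i.insertNth t z)

section slice

variable {i : Fin 3}

@[simp] lemma slicePt_apply_same (t : ℝ) (z : Fin 2 → ℝ) : slicePt i t z i = t := by
  simp [slicePt]

@[simp] lemma slicePt_apply_succAbove (t : ℝ) (z : Fin 2 → ℝ) (k : Fin 2) :
    slicePt i t z (i.succAbove k) = z k := by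
  simp [slicePt]

lemma measurePreserving_slicePt :
    MeasurePreserving (fun p : ℝ × (Fin 2 → ℝ) => slicePt i p.1 p.2) volume volume :=
  (PiLp.volume_preserving_toLp (Fin 3)).comp
    (volume_preserving_piFinSuccAbove (fun _ : Fin 3 => ℝ) i).symm

lemma measurableEmbedding_slicePt :
    MeasurableEmbedding (fun p : ℝ × (Fin 2 → ℝ) => slicePt i p.1 p.2) :=
  (MeasurableEquiv.toLp 2 (Fin 3 → ℝ)).measurableEmbedding.comp
    (MeasurableEquiv.piFinSuccAbove (fun _ : Fin 3 => ℝ) i).symm.measurableEmbedding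

lemma measurable_slicePt :
    Measurable (fun p : ℝ × (Fin 2 → ℝ) => slicePt i p.1 p.2) :=
  measurableEmbedding_slicePt.measurable

lemma measurable_slicePt_left (t : ℝ) : Measurable (slicePt i t) :=
  measurable_slicePt.comp measurable_prodMk_left

lemma lintegral_eq_lintegral_slicePt (i : Fin 3) {g : E3 → ℝ≥0∞} (hg : Measurable g) :
    ∫⁻ x, g x = ∫⁻ t, ∫⁻ z, g (slicePt i t z) := by
  rw [← (measurePreserving_slicePt (i := i)).lintegral_comp hg, Measure.volume_eq_prod, lintegral_prod]
  exact (hg.comp measurable_slicePt).aemeasurable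

lemma integrable_comp_slicePt {g : E3 → ℝ} (hg : Integrable g) :
    Integrable (fun p : ℝ × (Fin 2 → ℝ) => g (slicePt i p.1 p.2)) (volume.prod volume) :=
  (measurePreserving_slicePt.integrable_comp_emb measurableEmbedding_slicePt).2 hg

lemma integral_eq_integral_slicePt {g : E3 → ℝ} (hg : Integrable g) :
    ∫ x, g x = ∫ z, ∫ t, g (slicePt i t z) := by
  rw [← (measurePreserving_slicePt (i := i)).integral_comp measurableEmbedding_slicePt,
    Measure.volume_eq_prod, integral_prod_symm]
  exact integrable_comp_slicePt hg

lemma norm_sq_slicePt_sub_ge (s t : ℝ) (w z : Fin 2 → ℝ) :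
    (s - t) ^ 2 + ‖w - z‖ ^ 2 ≤ ‖slicePt i s w - slicePt i t z‖ ^ 2 := by
  rw [EuclideanSpace.norm_sq_eq, Fin.sum_univ_succAbove _ i]
  simp only [PiLp.sub_apply, slicePt_apply_same, slicePt_apply_succAbove, Real.norm_eq_abs, sq_abs]
  gcongr
  have h : ‖w - z‖ ≤ √(∑ k, (w k - z k) ^ 2) := by
    refine (pi_norm_le_iff_of_nonneg (by positivity)).2 fun k => ?_
    refine Real.abs_le_sqrt ?_
    exact Finset.single_le_sum (f := fun k => (w k - z k) ^ 2) (fun _ _ => sq_nonneg _)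
      (Finset.mem_univ k)
  calc ‖w - z‖ ^ 2 ≤ √(∑ k, (w k - z k) ^ 2) ^ 2 := by gcongr
    _ = _ := Real.sq_sqrt (Finset.sum_nonneg fun _ _ => sq_nonneg _)

lemma abs_le_norm_slicePt (t : ℝ) (z : Fin 2 → ℝ) : |t| ≤ ‖slicePt i t z‖ := by
  simpa using PiLp.norm_apply_le (slicePt i t z) i

lemma slicePt_add_smul_single (s h : ℝ) (z : Fin 2 → ℝ) :
    slicePt i (s + h) z = slicePt i s z + h • EuclideanSpace.single i 1 := by
  ext k
  rcases Fin.eq_self_or_eq_succAbove i k with rfl | ⟨m, rfl⟩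
  · simp
  · simp

/-- Replacing the `i`-th coordinate of a point by `t`. -/
def sliceProj (i : Fin 3) (t : ℝ) (y : E3) : E3 := y + (t - y i) • EuclideanSpace.single i 1

@[fun_prop]
lemma continuous_sliceProj (t : ℝ) : Continuous (sliceProj i t) := by
  unfold sliceProj; fun_prop

lemma sliceProj_slicePt (s t : ℝ) (z : Fin 2 → ℝ) :
    sliceProj i t (slicePt i s z) = slicePt i t z := by
  rw [sliceProj, slicePt_apply_same, ← slicePt_add_smul_single]; ring_nf

lemma sliceProj_add_smul_single {k : Fin 3} (hk : k ≠ i) (t h : ℝ) (y : E3) :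
    sliceProj i t (y + h • EuclideanSpace.single k 1) =
      sliceProj i t y + h • EuclideanSpace.single k 1 := by
  simp only [sliceProj, PiLp.add_apply, PiLp.smul_apply, PiLp.single_apply, hk.symm,
    if_false, smul_zero, add_zero]
  abel

end slice

section schwartz

/-- The partial derivative of a Schwartz function. -/
def spd (k : Fin 3) (f : SchwartzMap E3 ℝ) : SchwartzMap E3 ℝ :=
  LineDeriv.lineDerivOp (EuclideanSpace.single k (1 : ℝ) : E3) f

lemma spd_apply (k : Fin 3) (f : SchwartzMap E3 ℝ) (x : E3) :
    spd k f x = fderiv ℝ f x (EuclideanSpace.single k 1) :=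
  SchwartzMap.lineDerivOp_apply_eq_fderiv _ _ _

lemma coe_spd (k : Fin 3) (f : SchwartzMap E3 ℝ) : ⇑(spd k f) = pd k f :=
  funext fun x => spd_apply k f x

lemma spd_comm (j k : Fin 3) (f : SchwartzMap E3 ℝ) : spd j (spd k f) = spd k (spd j f) := by
  ext x
  have hd : DifferentiableAt ℝ (fderiv ℝ f) x :=
    ((f.smooth 2).fderiv_right (m := 1) (by norm_num)).differentiable (by norm_num) x
  have h : ∀ m n : Fin 3, spd m (spd n f) x =
      fderiv ℝ (fderiv ℝ f) x (EuclideanSpace.single m 1) (EuclideanSpace.single n 1) := by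
    intro m n
    rw [spd_apply, show ⇑(spd n f) = fun y => fderiv ℝ f y (EuclideanSpace.single n 1) from
      funext fun y => spd_apply n f y, fderiv_clm_apply hd (differentiableAt_const _)]
    simp
  rw [h, h]
  exact ((f.smooth 2).contDiffAt.isSymmSndFDerivAt (by simp)).eq _ _

lemma hasLineDerivAt_schwartz (k : Fin 3) (f : SchwartzMap E3 ℝ) (x : E3) :
    HasLineDerivAt ℝ f (spd k f x) x (EuclideanSpace.single k 1) := by
  rw [spd_apply]
  exact f.differentiableAt.hasFDerivAt.hasLineDerivAt _

lemma integrable_bdd_mul_schwartz {a : E3 → ℝ} (ha : Measurable a) {c : ℝ} (hc : ∀ x, |a x| ≤ c)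
    (f : SchwartzMap E3 ℝ) : Integrable fun x => a x * f x :=
  f.integrable.bdd_mul ha.aestronglyMeasurable (Filter.Eventually.of_forall hc)

lemma integral_mul_spd {a a' : E3 → ℝ} (ha : Measurable a) (ha' : Measurable a') {c c' : ℝ}
    (hc : ∀ x, |a x| ≤ c) (hc' : ∀ x, |a' x| ≤ c') (k : Fin 3)
    (hd : ∀ x, HasLineDerivAt ℝ a (a' x) x (EuclideanSpace.single k 1)) (f : SchwartzMap E3 ℝ) :
    ∫ x, a x * spd k f x = -∫ x, a' x * f x :=
  integral_bilinear_hasLineDerivAt_right_eq_neg_left_of_integrable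
    (B := ContinuousLinearMap.mul ℝ ℝ)
    (integrable_bdd_mul_schwartz ha' hc' f) (integrable_bdd_mul_schwartz ha hc (spd k f))
    (integrable_bdd_mul_schwartz ha hc f) (fun x _ => hd x)
    (fun x _ => hasLineDerivAt_schwartz k f x)

lemma ae_integral_Iic_spd (i : Fin 3) (f : SchwartzMap E3 ℝ) (t : ℝ) :
    ∀ᵐ z : Fin 2 → ℝ, ∫ s in Set.Iic t, spd i f (slicePt i s z) = f (slicePt i t z) := by
  filter_upwards [(integrable_comp_slicePt (i := i) (spd i f).integrable).prod_left_ae] with z hz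
  have hd : ∀ s, HasDerivAt (fun s => f (slicePt i s z)) (spd i f (slicePt i s z)) s := by
    intro s
    have h := hasLineDerivAt_schwartz i f (slicePt i s z)
    have h2 : HasDerivAt (fun r => f (slicePt i s z + r • EuclideanSpace.single i 1))
      (spd i f (slicePt i s z)) (s - s) := by rw [sub_self]; exact h
    have h3 := HasDerivAt.comp (h := fun r => r - s) s h2 ((hasDerivAt_id s).sub_const s)
    simp only [mul_one] at h3
    refine h3.congr_of_eventuallyEq (Filter.Eventually.of_forall fun r => ?_)
    simp [← slicePt_add_smul_single]
  have hlim : Filter.Tendsto (fun s => slicePt i s z) Filter.atBot (Filter.cocompact E3) := by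
    rw [← Metric.cobounded_eq_cocompact, ← tendsto_norm_atTop_iff_cobounded]
    exact Filter.tendsto_atTop_mono (fun s => abs_le_norm_slicePt s z)
      Filter.tendsto_abs_atBot_atTop
  have h := integral_Iic_of_hasDerivAt_of_tendsto (a := t) (hd t).continuousAt.continuousWithinAt
    (fun s _ => hd s) hz.integrableOn (f.tendsto_cocompact.comp hlim)
  rw [h, sub_zero]

end schwartz

section sliceIdentity

variable {ε : ℝ} {i j : Fin 3}

/-- The extension of the kernel from the hyperplane `y i = t` to the half-space `y i ≤ t`,
constant in the direction `i` and vanishing on the complementary half-space. -/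
def sliceKernel (ε : ℝ) (i j : Fin 3) (x : E3) (t : ℝ) : E3 → ℝ :=
  {y | y i ≤ t}.indicator fun y => regKernel ε j (x - sliceProj i t y)

/-- The tangential derivatives of `sliceKernel`. -/
def sliceKernelDeriv (ε : ℝ) (i j k : Fin 3) (x : E3) (t : ℝ) : E3 → ℝ :=
  {y | y i ≤ t}.indicator fun y => -regKernelDeriv ε j k (x - sliceProj i t y)

lemma measurableSet_coord_le (t : ℝ) : MeasurableSet {y : E3 | y i ≤ t} :=
  measurableSet_le (by fun_prop) measurable_const

lemma measurable_sliceKernel (hε : 0 < ε) (x : E3) (t : ℝ) :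
    Measurable (sliceKernel ε i j x t) :=
  ((continuous_regKernel hε j).comp (by fun_prop)).measurable.indicator (measurableSet_coord_le t)

lemma measurable_sliceKernelDeriv (hε : 0 < ε) (k : Fin 3) (x : E3) (t : ℝ) :
    Measurable (sliceKernelDeriv ε i j k x t) :=
  ((continuous_regKernelDeriv hε j k).comp (by fun_prop)).neg.measurable.indicator
    (measurableSet_coord_le t)

lemma abs_regKernel_le_const (hε : 0 < ε) (j : Fin 3) (x : E3) :
    |regKernel ε j x| ≤ (ε ^ 2) ^ (-1 : ℝ) :=
  (abs_regKernel_le hε j x).trans (rpow_regSq_le hε (by norm_num) x)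

lemma abs_sliceKernel_le (hε : 0 < ε) (x : E3) (t : ℝ) (y : E3) :
    |sliceKernel ε i j x t y| ≤ (ε ^ 2) ^ (-1 : ℝ) := by
  unfold sliceKernel Set.indicator
  split_ifs
  · exact abs_regKernel_le_const hε j _
  · rw [abs_zero]; positivity

lemma abs_sliceKernelDeriv_le (hε : 0 < ε) (k : Fin 3) (x : E3) (t : ℝ) (y : E3) :
    |sliceKernelDeriv ε i j k x t y| ≤ 4 * regSq ε (x - sliceProj i t y) ^ (-(3 / 2) : ℝ) := by
  unfold sliceKernelDeriv Set.indicator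
  split_ifs
  · rw [abs_neg]; exact abs_regKernelDeriv_le hε j k _
  · rw [abs_zero]; have := regSq_pos hε (x - sliceProj i t y); positivity

lemma hasLineDerivAt_sliceKernel (hε : 0 < ε) {k : Fin 3} (hk : k ≠ i) (x : E3) (t : ℝ) (y : E3) :
    HasLineDerivAt ℝ (sliceKernel ε i j x t) (sliceKernelDeriv ε i j k x t y) y
      (EuclideanSpace.single k 1) := by
  have hc : ∀ r : ℝ, (y + r • EuclideanSpace.single k (1 : ℝ)) i = y i := by
    intro r; simp [hk.symm]
  unfold HasLineDerivAt sliceKernel sliceKernelDeriv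
  simp only [Set.indicator, Set.mem_ofPred_eq, hc]
  split_ifs
  · have h := hasLineDerivAt_regKernel hε (x - sliceProj i t y) j k
    unfold HasLineDerivAt at h
    rw [← neg_zero] at h
    have h2 := HasDerivAt.comp (h := fun r => -r) (0 : ℝ) h (hasDerivAt_neg 0)
    rw [mul_neg_one] at h2
    refine h2.congr_of_eventuallyEq (Filter.Eventually.of_forall fun r => ?_)
    simp only [Function.comp, sliceProj_add_smul_single hk, neg_smul]
    congr 1
    abel
  · exact hasDerivAt_const _ _

lemma integral_slice_regKernel (hε : 0 < ε) (f : Fin 3 → SchwartzMap E3 ℝ)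
    (hdiv : ∀ x, ∑ k, spd k (f k) x = 0) (x : E3) (t : ℝ) :
    ∫ z, regKernel ε j (x - slicePt i t z) * f i (slicePt i t z) =
      ∑ k : Fin 2, ∫ y, sliceKernelDeriv ε i j (i.succAbove k) x t y * f (i.succAbove k) y := by
  have hK : ∀ g : SchwartzMap E3 ℝ, Integrable fun y => sliceKernel ε i j x t y * g y := fun g =>
    integrable_bdd_mul_schwartz (measurable_sliceKernel hε x t) (abs_sliceKernel_le hε x t) g
  have h1 : ∫ y, sliceKernel ε i j x t y * spd i (f i) y =
      ∫ z, regKernel ε j (x - slicePt i t z) * f i (slicePt i t z) := by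
    rw [integral_eq_integral_slicePt (i := i) (hK _)]
    refine integral_congr_ae ?_
    filter_upwards [ae_integral_Iic_spd i (f i) t] with z hz
    rw [← hz, ← integral_const_mul, ← integral_indicator measurableSet_Iic]
    congr 1
    ext s
    simp only [sliceKernel, Set.indicator, Set.mem_ofPred_eq, slicePt_apply_same, Set.mem_Iic,
      sliceProj_slicePt]
    split_ifs <;> simp
  have h2 : ∑ k, ∫ y, sliceKernel ε i j x t y * spd k (f k) y = 0 := by
    rw [← integral_finsetSum _ fun k _ => hK _]
    simp [← Finset.mul_sum, hdiv]
  rw [Fin.sum_univ_succAbove _ i, h1] at h2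
  rw [eq_neg_of_add_eq_zero_left h2, ← Finset.sum_neg_distrib]
  refine Finset.sum_congr rfl fun k _ => ?_
  rw [integral_mul_spd (measurable_sliceKernel hε x t) (measurable_sliceKernelDeriv hε _ x t)
    (abs_sliceKernel_le hε x t) (fun y => (abs_sliceKernelDeriv_le hε _ x t y).trans
      (mul_le_mul_of_nonneg_left (rpow_regSq_le hε (by norm_num) _) (by norm_num))) _
    (hasLineDerivAt_sliceKernel hε (i.succAbove_ne k) x t), neg_neg]

end sliceIdentity

/-- The coordinates of `y` other than the `i`-th one. -/
def sliceCoord (i : Fin 3) (y : E3) : Fin 2 → ℝ := fun k => y (i.succAbove k)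

lemma continuous_sliceCoord (i : Fin 3) : Continuous (sliceCoord i) := by
  unfold sliceCoord; fun_prop

lemma sliceProj_eq_slicePt (i : Fin 3) (t : ℝ) (y : E3) :
    sliceProj i t y = slicePt i t (sliceCoord i y) := by
  ext k
  rcases Fin.eq_self_or_eq_succAbove i k with rfl | ⟨m, rfl⟩
  · simp [sliceProj]
  · simp [sliceProj, sliceCoord]

lemma lintegral_mul_lintegral_bracket_le {Y : Type*} [MeasurableSpace Y] {ν : Measure Y} [SFinite ν]
    {G : (Fin 2 → ℝ) → ℝ≥0∞} (hG : Measurable G) {h : Y → ℝ≥0∞} (hh : Measurable h)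
    {c : Y → Fin 2 → ℝ} (hc : Measurable c) {τ : ℝ} (hτ : τ ≠ 0) (α : ℝ) :
    ∫⁻ w, G w * ∫⁻ y, ENNReal.ofReal ((τ ^ 2 + ‖w - c y‖ ^ 2) ^ (-α)) * h y ∂ν ≤
      planarBracket (3 / 2 * α) ^ (2 / 3 : ℝ) * ENNReal.ofReal (|τ| ^ ((4 - 6 * α) / 3)) *
        (∫⁻ w, G w ^ 3) ^ (1 / 3 : ℝ) * ∫⁻ y, h y ∂ν := by
  have hm : Measurable fun p : (Fin 2 → ℝ) × Y =>
      ENNReal.ofReal ((τ ^ 2 + ‖p.1 - c p.2‖ ^ 2) ^ (-α)) := by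
    fun_prop
  have hm1 : Measurable fun p : (Fin 2 → ℝ) × Y =>
      ENNReal.ofReal ((τ ^ 2 + ‖p.1 - c p.2‖ ^ 2) ^ (-α)) * h p.2 := by
    fun_prop
  calc _ = ∫⁻ w, ∫⁻ y, G w * (ENNReal.ofReal ((τ ^ 2 + ‖w - c y‖ ^ 2) ^ (-α)) * h y) ∂ν := by
        refine lintegral_congr fun w => ?_
        exact (lintegral_const_mul _ (hm1.comp measurable_prodMk_left)).symm
    _ = ∫⁻ y, (∫⁻ w, G w * (ENNReal.ofReal ((τ ^ 2 + ‖w - c y‖ ^ 2) ^ (-α)) * h y)) ∂ν := by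
        refine lintegral_lintegral_swap ?_
        exact ((hG.comp measurable_fst).mul hm1).aemeasurable
    _ = ∫⁻ y, (∫⁻ w, ENNReal.ofReal ((τ ^ 2 + ‖w - c y‖ ^ 2) ^ (-α)) * G w) * h y ∂ν := by
        refine lintegral_congr fun y => ?_
        rw [← lintegral_mul_const]
        · exact lintegral_congr fun w => by ring
        · exact (hm.comp measurable_prodMk_right).mul hG
    _ ≤ ∫⁻ y, planarBracket (3 / 2 * α) ^ (2 / 3 : ℝ) * ENNReal.ofReal (|τ| ^ ((4 - 6 * α) / 3)) *
        (∫⁻ w, G w ^ 3) ^ (1 / 3 : ℝ) * h y ∂ν := by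
        gcongr with y
        exact lintegral_mul_bracket_le hG hτ α (c y)
    _ = _ := lintegral_const_mul _ hh

/-- The constant in the weighted estimate for the regularized Newtonian gradient. -/
def newtonConst : ℝ≥0∞ :=
  (planarBracket (3 / 2) ^ (2 / 3 : ℝ) + 4 * planarBracket (9 / 4) ^ (2 / 3 : ℝ)) *
    (shellConst * 960 ^ (1 / 3 : ℝ))

lemma newtonConst_ne_top : newtonConst ≠ ⊤ := by
  unfold newtonConst
  refine ENNReal.mul_ne_top (ENNReal.add_ne_top.2 ⟨?_, ?_⟩) ?_
  · exact ENNReal.rpow_ne_top_of_nonneg (by norm_num) (planarBracket_ne_top (by norm_num))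
  · exact ENNReal.mul_ne_top (by simp)
      (ENNReal.rpow_ne_top_of_nonneg (by norm_num) (planarBracket_ne_top (by norm_num)))
  · exact ENNReal.mul_ne_top shellConst_ne_top (ENNReal.rpow_ne_top_of_nonneg (by norm_num) (by simp))

section weighted

variable {ε : ℝ} {i j : Fin 3}

lemma rpow_regSq_slicePt_le {s t : ℝ} (hst : s - t ≠ 0) {α : ℝ} (hα : 0 ≤ α) (w z : Fin 2 → ℝ) :
    regSq ε (slicePt i s w - slicePt i t z) ^ (-α) ≤ ((s - t) ^ 2 + ‖w - z‖ ^ 2) ^ (-α) := by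
  refine rpow_le_rpow_of_nonpos (by positivity) ?_ (by linarith)
  exact (norm_sq_slicePt_sub_ge s t w z).trans (by unfold regSq; linarith [sq_nonneg ε])

/-- The contribution of the hyperplane `y i = t` to the regularized Newtonian gradient. -/
def sliceConv (ε : ℝ) (i j : Fin 3) (f : SchwartzMap E3 ℝ) (t : ℝ) (x : E3) : ℝ :=
  ∫ z, regKernel ε j (x - slicePt i t z) * f (slicePt i t z)

lemma enorm_sliceConv_le (hε : 0 < ε) (f : SchwartzMap E3 ℝ) {s t : ℝ} (hst : s - t ≠ 0)
    (w : Fin 2 → ℝ) :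
    ‖sliceConv ε i j f t (slicePt i s w)‖ₑ ≤
      ∫⁻ z, ENNReal.ofReal (((s - t) ^ 2 + ‖w - z‖ ^ 2) ^ (-(1 : ℝ))) * ‖f (slicePt i t z)‖ₑ := by
  refine (enorm_integral_le_lintegral_enorm _).trans ?_
  gcongr with z
  rw [enorm_mul]
  gcongr
  rw [Real.enorm_eq_ofReal_abs]
  exact ENNReal.ofReal_le_ofReal ((abs_regKernel_le hε j _).trans
    (rpow_regSq_slicePt_le hst (by norm_num) w z))

lemma enorm_sliceConv_le_of_div (hε : 0 < ε) (f : Fin 3 → SchwartzMap E3 ℝ)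
    (hdiv : ∀ x, ∑ k, spd k (f k) x = 0) {s t : ℝ} (hst : s - t ≠ 0) (w : Fin 2 → ℝ) :
    ‖sliceConv ε i j (f i) t (slicePt i s w)‖ₑ ≤
      ∫⁻ y, ENNReal.ofReal (((s - t) ^ 2 + ‖w - sliceCoord i y‖ ^ 2) ^ (-(3 / 2 : ℝ))) *
        (4 * ∑ k, ‖f k y‖ₑ) := by
  rw [sliceConv, integral_slice_regKernel hε f hdiv]
  have hterm : ∀ k : Fin 2, ‖∫ y, sliceKernelDeriv ε i j (i.succAbove k) (slicePt i s w) t y *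
      f (i.succAbove k) y‖ₑ ≤
      ∫⁻ y, ENNReal.ofReal (((s - t) ^ 2 + ‖w - sliceCoord i y‖ ^ 2) ^ (-(3 / 2 : ℝ))) *
        (4 * ‖f (i.succAbove k) y‖ₑ) := by
    intro k
    refine (enorm_integral_le_lintegral_enorm _).trans ?_
    gcongr with y
    rw [enorm_mul, ← mul_assoc]
    gcongr
    rw [Real.enorm_eq_ofReal_abs, mul_comm, show (4 : ℝ≥0∞) = ENNReal.ofReal 4 by simp,
      ← ENNReal.ofReal_mul (by norm_num)]
    refine ENNReal.ofReal_le_ofReal ((abs_sliceKernelDeriv_le hε _ _ t y).trans ?_)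
    rw [sliceProj_eq_slicePt]
    exact mul_le_mul_of_nonneg_left (rpow_regSq_slicePt_le hst (by norm_num) w _) (by norm_num)
  have hc : Continuous fun y => sliceCoord i y := continuous_sliceCoord i
  have hm : Measurable fun y => ENNReal.ofReal
      (((s - t) ^ 2 + ‖w - sliceCoord i y‖ ^ 2) ^ (-(3 / 2 : ℝ))) := by
    have := hc.measurable
    fun_prop
  calc _ ≤ ∑ k : Fin 2, ‖∫ y, sliceKernelDeriv ε i j (i.succAbove k) (slicePt i s w) t y *
      f (i.succAbove k) y‖ₑ := enorm_sum_le _ _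
    _ ≤ ∑ k : Fin 2, ∫⁻ y, ENNReal.ofReal
          (((s - t) ^ 2 + ‖w - sliceCoord i y‖ ^ 2) ^ (-(3 / 2 : ℝ))) *
            (4 * ‖f (i.succAbove k) y‖ₑ) := Finset.sum_le_sum fun k _ => hterm k
    _ = ∫⁻ y, ∑ k : Fin 2, ENNReal.ofReal
          (((s - t) ^ 2 + ‖w - sliceCoord i y‖ ^ 2) ^ (-(3 / 2 : ℝ))) *
            (4 * ‖f (i.succAbove k) y‖ₑ) := by
        refine (lintegral_finsetSum _ fun k _ => ?_).symm
        exact hm.mul ((f _).continuous.enorm.measurable.const_mul 4)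
    _ ≤ _ := by
        gcongr with y
        rw [← Finset.mul_sum, ← Finset.mul_sum, Fin.sum_univ_succAbove _ i]
        gcongr
        exact le_add_self

lemma measurable_sliceConv (hε : 0 < ε) (f : SchwartzMap E3 ℝ) :
    Measurable fun p : (ℝ × (Fin 2 → ℝ)) × ℝ => sliceConv ε i j f p.2 (slicePt i p.1.1 p.1.2) := by
  have h : Measurable fun q : ((ℝ × (Fin 2 → ℝ)) × ℝ) × (Fin 2 → ℝ) =>
      regKernel ε j (slicePt i q.1.1.1 q.1.1.2 - slicePt i q.1.2 q.2) *
        f (slicePt i q.1.2 q.2) := by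
    have h1 : Measurable fun q : ((ℝ × (Fin 2 → ℝ)) × ℝ) × (Fin 2 → ℝ) =>
        slicePt i q.1.1.1 q.1.1.2 := measurable_slicePt.comp (measurable_fst.comp measurable_fst)
    have h2 : Measurable fun q : ((ℝ × (Fin 2 → ℝ)) × ℝ) × (Fin 2 → ℝ) =>
        slicePt i q.1.2 q.2 := measurable_slicePt.comp (by fun_prop :
          Measurable fun q : ((ℝ × (Fin 2 → ℝ)) × ℝ) × (Fin 2 → ℝ) => (q.1.2, q.2))
    exact ((continuous_regKernel hε j).measurable.comp (h1.sub h2)).mul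
      (f.continuous.measurable.comp h2)
  exact h.stronglyMeasurable.integral_prod_right'.measurable

lemma lintegral_mul_enorm_sliceConv_le (hε : 0 < ε) (f : Fin 3 → SchwartzMap E3 ℝ)
    (hdiv : ∀ x, ∑ k, spd k (f k) x = 0) {L : ℝ} (hL : 0 < L)
    (hfL : ∑ k, ∫⁻ y, ‖f k y‖ₑ ≤ ENNReal.ofReal L) {G : (Fin 2 → ℝ) → ℝ≥0∞} (hG : Measurable G)
    {s t : ℝ} (hst : s ≠ t) :
    ∫⁻ w, G w * ‖sliceConv ε i j (f i) t (slicePt i s w)‖ₑ ≤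
      (planarBracket (3 / 2) ^ (2 / 3 : ℝ) + 4 * planarBracket (9 / 4) ^ (2 / 3 : ℝ)) *
        ((∫⁻ w, G w ^ 3) ^ (1 / 3 : ℝ) *
          min ((∫⁻ z, ‖f i (slicePt i t z)‖ₑ) * ENNReal.ofReal (|s - t| ^ (-(2 / 3) : ℝ)))
            (ENNReal.ofReal (L * |s - t| ^ (-(5 / 3) : ℝ)))) := by
  have hst' : s - t ≠ 0 := sub_ne_zero.2 hst
  rcases le_total ((∫⁻ z, ‖f i (slicePt i t z)‖ₑ) * ENNReal.ofReal (|s - t| ^ (-(2 / 3) : ℝ)))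
    (ENNReal.ofReal (L * |s - t| ^ (-(5 / 3) : ℝ))) with h | h
  · rw [min_eq_left h]
    have h1 := lintegral_mul_lintegral_bracket_le (ν := volume) hG (c := id)
      ((f i).continuous.enorm.measurable.comp (measurable_slicePt_left (i := i) t))
      measurable_id hst' 1
    calc _ ≤ ∫⁻ w, G w * ∫⁻ z, ENNReal.ofReal (((s - t) ^ 2 + ‖w - z‖ ^ 2) ^ (-(1 : ℝ))) *
            ‖f i (slicePt i t z)‖ₑ := by
          gcongr with w
          exact enorm_sliceConv_le hε (f i) hst' w
      _ ≤ _ := h1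
      _ = planarBracket (3 / 2) ^ (2 / 3 : ℝ) * ((∫⁻ w, G w ^ 3) ^ (1 / 3 : ℝ) *
          ((∫⁻ z, ‖f i (slicePt i t z)‖ₑ) * ENNReal.ofReal (|s - t| ^ (-(2 / 3) : ℝ)))) := by
          norm_num [Function.comp_def]
          ring
      _ ≤ _ := by gcongr; exact le_self_add
  · rw [min_eq_right h]
    have hS : Measurable fun y => 4 * ∑ k, ‖f k y‖ₑ :=
      (Finset.measurable_fun_sum _ fun k _ => (f k).continuous.enorm.measurable).const_mul 4
    have h1 := lintegral_mul_lintegral_bracket_le (ν := volume) hG hS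
      (continuous_sliceCoord i).measurable hst' (3 / 2)
    have h2 : ∫⁻ y, 4 * ∑ k, ‖f k y‖ₑ ≤ 4 * ENNReal.ofReal L := by
      rw [lintegral_const_mul _ (Finset.measurable_fun_sum _ fun k _ =>
        (f k).continuous.enorm.measurable),
        lintegral_finsetSum _ fun k _ => (f k).continuous.enorm.measurable]
      gcongr
    calc _ ≤ ∫⁻ w, G w * ∫⁻ y, ENNReal.ofReal
            (((s - t) ^ 2 + ‖w - sliceCoord i y‖ ^ 2) ^ (-(3 / 2 : ℝ))) *
              (4 * ∑ k, ‖f k y‖ₑ) := by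
          gcongr with w
          exact enorm_sliceConv_le_of_div hε f hdiv hst' w
      _ ≤ _ := h1
      _ ≤ planarBracket (9 / 4) ^ (2 / 3 : ℝ) * ENNReal.ofReal (|s - t| ^ (-(5 / 3) : ℝ)) *
          (∫⁻ w, G w ^ 3) ^ (1 / 3 : ℝ) * (4 * ENNReal.ofReal L) := by
          rw [show (4 - 6 * (3 / 2 : ℝ)) / 3 = -(5 / 3) by norm_num,
            show (3 / 2 * (3 / 2) : ℝ) = 9 / 4 by norm_num]
          gcongr
      _ = 4 * planarBracket (9 / 4) ^ (2 / 3 : ℝ) * ((∫⁻ w, G w ^ 3) ^ (1 / 3 : ℝ) *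
            ENNReal.ofReal (L * |s - t| ^ (-(5 / 3) : ℝ))) := by
          rw [ENNReal.ofReal_mul hL.le]; ring
      _ ≤ _ := by gcongr; exact le_add_self

lemma enorm_integral_regKernel_le (hε : 0 < ε) (f : SchwartzMap E3 ℝ) (x : E3) :
    ‖∫ y, regKernel ε j (x - y) * f y‖ₑ ≤ ∫⁻ t, ‖sliceConv ε i j f t x‖ₑ := by
  have hI : Integrable fun y => regKernel ε j (x - y) * f y :=
    integrable_bdd_mul_schwartz ((continuous_regKernel hε j).comp (by fun_prop)).measurable
      (fun y => abs_regKernel_le_const hε j (x - y)) f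
  rw [← (measurePreserving_slicePt (i := i)).integral_comp measurableEmbedding_slicePt,
    Measure.volume_eq_prod, integral_prod _ (integrable_comp_slicePt hI)]
  exact enorm_integral_le_lintegral_enorm _

attribute [irreducible] sliceConv

lemma lintegral_mul_enorm_integral_regKernel_le (hε : 0 < ε) (f : Fin 3 → SchwartzMap E3 ℝ)
    (hdiv : ∀ x, ∑ k, spd k (f k) x = 0) {L : ℝ} (hL : 0 < L)
    (hfL : ∑ k, ∫⁻ y, ‖f k y‖ₑ ≤ ENNReal.ofReal L) {g : E3 → ℝ≥0∞} (hg : Measurable g) :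
    ∫⁻ x, g x * ‖∫ y, regKernel ε j (x - y) * f i y‖ₑ ≤
      newtonConst * ENNReal.ofReal L * (∫⁻ x, g x ^ 3) ^ (1 / 3 : ℝ) := by
  have hgs : Measurable fun p : ℝ × (Fin 2 → ℝ) => g (slicePt i p.1 p.2) :=
    hg.comp measurable_slicePt
  have hR := (measurable_sliceConv (i := i) (j := j) hε (f i)).enorm
  obtain ⟨γ, hγ⟩ : ∃ γ : ℝ → ℝ≥0∞, γ = fun s => (∫⁻ w, g (slicePt i s w) ^ 3) ^ (1 / 3 : ℝ) :=
    ⟨_, rfl⟩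
  obtain ⟨F, hF⟩ : ∃ F : ℝ → ℝ≥0∞, F = fun t => ∫⁻ z, ‖f i (slicePt i t z)‖ₑ := ⟨_, rfl⟩
  obtain ⟨A, hA⟩ : ∃ A : ℝ≥0∞, A = planarBracket (3 / 2) ^ (2 / 3 : ℝ) +
    4 * planarBracket (9 / 4) ^ (2 / 3 : ℝ) := ⟨_, rfl⟩
  have hγm : Measurable γ := by
    have h : Measurable fun s => ∫⁻ w, g (slicePt i s w) ^ 3 :=
      Measurable.lintegral_prod_right' (f := fun p : ℝ × (Fin 2 → ℝ) => g (slicePt i p.1 p.2) ^ 3)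
        (hgs.pow_const 3)
    rw [hγ]
    exact h.pow_const _
  have hFm : Measurable F := by
    rw [hF]
    exact Measurable.lintegral_prod_right'
      (f := fun p : ℝ × (Fin 2 → ℝ) => ‖f i (slicePt i p.1 p.2)‖ₑ)
      ((f i).continuous.enorm.measurable.comp (measurable_slicePt (i := i)))
  have hFL : ∫⁻ t, F t ≤ ENNReal.ofReal L := by
    rw [hF, ← lintegral_eq_lintegral_slicePt i (f i).continuous.enorm.measurable]
    exact (Finset.single_le_sum (f := fun k => ∫⁻ y, ‖f k y‖ₑ) (fun _ _ => zero_le)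
      (Finset.mem_univ i)).trans hfL
  have hγ3 : ∫⁻ s, γ s ^ 3 = ∫⁻ x, g x ^ 3 := by
    rw [lintegral_eq_lintegral_slicePt i (hg.pow_const 3)]
    refine lintegral_congr fun s => ?_
    rw [hγ, ← ENNReal.rpow_natCast, ← ENNReal.rpow_mul]
    norm_num
  have hslice : ∀ s t, s ≠ t →
      ∫⁻ w, g (slicePt i s w) * ‖sliceConv ε i j (f i) t (slicePt i s w)‖ₑ ≤
        A * (γ s * min (F t * ENNReal.ofReal (|s - t| ^ (-(2 / 3) : ℝ)))
          (ENNReal.ofReal (L * |s - t| ^ (-(5 / 3) : ℝ)))) := by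
    intro s t hs
    rw [hA, hγ, hF]
    exact lintegral_mul_enorm_sliceConv_le hε f hdiv hL hfL
      (hg.comp (measurable_slicePt_left s)) hs
  have hmeas3 : Measurable fun p : (ℝ × ℝ) × (Fin 2 → ℝ) =>
      g (slicePt i p.1.1 p.2) * ‖sliceConv ε i j (f i) p.1.2 (slicePt i p.1.1 p.2)‖ₑ := by
    have h1 : Measurable fun p : (ℝ × ℝ) × (Fin 2 → ℝ) => (p.1.1, p.2) := by fun_prop
    have h2 : Measurable fun p : (ℝ × ℝ) × (Fin 2 → ℝ) => ((p.1.1, p.2), p.1.2) := by fun_prop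
    have h3 : Measurable fun p : (ℝ × ℝ) × (Fin 2 → ℝ) => g (slicePt i p.1.1 p.2) := hgs.comp h1
    have h4 := hR.comp h2
    simp only [Function.comp_def] at h4
    exact h3.mul h4
  calc ∫⁻ x, g x * ‖∫ y, regKernel ε j (x - y) * f i y‖ₑ
      = ∫⁻ s, ∫⁻ w, g (slicePt i s w) *
          ‖∫ y, regKernel ε j (slicePt i s w - y) * f i y‖ₑ := by
        refine lintegral_eq_lintegral_slicePt i (hg.mul ?_)
        have : Measurable fun p : E3 × E3 => regKernel ε j (p.1 - p.2) * f i p.2 :=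
          ((continuous_regKernel hε j).comp (by fun_prop)).measurable.mul
            ((f i).continuous.comp continuous_snd).measurable
        exact this.stronglyMeasurable.integral_prod_right'.measurable.enorm
    _ ≤ ∫⁻ s, ∫⁻ w, g (slicePt i s w) * ∫⁻ t, ‖sliceConv ε i j (f i) t (slicePt i s w)‖ₑ := by
        gcongr with s w
        exact enorm_integral_regKernel_le hε (f i) _
    _ = ∫⁻ s, ∫⁻ w, ∫⁻ t, g (slicePt i s w) * ‖sliceConv ε i j (f i) t (slicePt i s w)‖ₑ := by
        refine lintegral_congr fun s => lintegral_congr fun w => ?_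
        have h : Measurable fun t => ‖sliceConv ε i j (f i) t (slicePt i s w)‖ₑ :=
          hR.comp (measurable_prodMk_left (x := (s, w)))
        exact (lintegral_const_mul _ h).symm
    _ = ∫⁻ s, ∫⁻ t, ∫⁻ w, g (slicePt i s w) * ‖sliceConv ε i j (f i) t (slicePt i s w)‖ₑ := by
        refine lintegral_congr fun s => lintegral_lintegral_swap ?_
        exact (hmeas3.comp (by fun_prop :
          Measurable fun p : (Fin 2 → ℝ) × ℝ => ((s, p.2), p.1))).aemeasurable
    _ = ∫⁻ t, ∫⁻ s, ∫⁻ w, g (slicePt i s w) * ‖sliceConv ε i j (f i) t (slicePt i s w)‖ₑ :=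
        lintegral_lintegral_swap hmeas3.lintegral_prod_right'.aemeasurable
    _ ≤ ∫⁻ t, ∫⁻ s, A * (γ s * min (F t * ENNReal.ofReal (|s - t| ^ (-(2 / 3) : ℝ)))
          (ENNReal.ofReal (L * |s - t| ^ (-(5 / 3) : ℝ)))) := by
        refine lintegral_mono fun t => lintegral_mono_ae ?_
        filter_upwards [Measure.ae_ne volume t] with s hs
        exact hslice s t hs
    _ = A * ∫⁻ t, ∫⁻ s, γ s * min (F t * ENNReal.ofReal (|s - t| ^ (-(2 / 3) : ℝ)))
          (ENNReal.ofReal (L * |s - t| ^ (-(5 / 3) : ℝ))) := by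
        have hm : Measurable fun p : ℝ × ℝ => γ p.2 *
            min (F p.1 * ENNReal.ofReal (|p.2 - p.1| ^ (-(2 / 3) : ℝ)))
              (ENNReal.ofReal (L * |p.2 - p.1| ^ (-(5 / 3) : ℝ))) := by
          refine (hγm.comp measurable_snd).mul (((hFm.comp measurable_fst).mul ?_).min ?_)
          · exact ((measurable_snd.sub measurable_fst).abs.pow_const _).ennreal_ofReal
          · exact (((measurable_snd.sub measurable_fst).abs.pow_const _).const_mul _).ennreal_ofReal
        rw [← lintegral_const_mul _ hm.lintegral_prod_right']
        refine lintegral_congr fun t => ?_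
        exact lintegral_const_mul _ (hm.comp measurable_prodMk_left)
    _ ≤ A * (shellConst * 960 ^ (1 / 3 : ℝ) * ENNReal.ofReal L *
          (∫⁻ s, γ s ^ 3) ^ (1 / 3 : ℝ)) := by
        gcongr
        exact lintegral_lintegral_mul_min_rpow_le hγm hFm hL hFL
    _ = _ := by rw [hγ3, newtonConst, ← hA]; ring

end weighted

section mollification

variable {ε : ℝ}

lemma hasLineDerivAt_regKernel_sub (hε : 0 < ε) (x : E3) (j k : Fin 3) (y : E3) :
    HasLineDerivAt ℝ (fun y => regKernel ε j (x - y)) (-regKernelDeriv ε j k (x - y)) y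
      (EuclideanSpace.single k 1) := by
  have h := hasLineDerivAt_regKernel hε (x - y) j k
  unfold HasLineDerivAt at h ⊢
  rw [← neg_zero] at h
  have h2 := HasDerivAt.comp (h := fun r => -r) (0 : ℝ) h (hasDerivAt_neg 0)
  rw [mul_neg_one] at h2
  refine h2.congr_of_eventuallyEq (Filter.Eventually.of_forall fun r => ?_)
  simp only [Function.comp, neg_smul]
  congr 1
  abel

lemma abs_regKernelDeriv_le_const (hε : 0 < ε) (j k : Fin 3) (x : E3) :
    |regKernelDeriv ε j k x| ≤ 4 * (ε ^ 2) ^ (-(3 / 2) : ℝ) :=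
  (abs_regKernelDeriv_le hε j k x).trans
    (mul_le_mul_of_nonneg_left (rpow_regSq_le hε (by norm_num) _) (by norm_num))

lemma integral_regKernel_mul_spd (hε : 0 < ε) (j k : Fin 3) (x : E3) (h : SchwartzMap E3 ℝ) :
    ∫ y, regKernel ε j (x - y) * spd k h y = ∫ y, regKernelDeriv ε j k (x - y) * h y := by
  have h := integral_mul_spd (a := fun y => regKernel ε j (x - y))
    (a' := fun y => -regKernelDeriv ε j k (x - y))
    ((continuous_regKernel hε j).comp (by fun_prop)).measurable
    ((continuous_regKernelDeriv hε j k).comp (by fun_prop)).neg.measurable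
    (fun y => abs_regKernel_le_const hε j (x - y))
    (fun y => by rw [abs_neg]; exact abs_regKernelDeriv_le_const hε j k (x - y)) k
    (fun y => hasLineDerivAt_regKernel_sub hε x j k y) h
  simpa [integral_neg] using h

lemma regKernelDeriv_comm (j k : Fin 3) (x : E3) :
    regKernelDeriv ε j k x = regKernelDeriv ε k j x := by
  simp only [regKernelDeriv, eq_comm (a := j), mul_comm (x j)]

lemma integral_regKernel_mul_laplacian (hε : 0 < ε) (j : Fin 3) (x : E3) (w : SchwartzMap E3 ℝ) :
    ∫ y, regKernel ε j (x - y) * ∑ k, spd k (spd k w) y =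
      ∫ y, regMollifier ε (x - y) * spd j w y := by
  have hK : ∀ (j : Fin 3) (g : SchwartzMap E3 ℝ), Integrable fun y => regKernel ε j (x - y) * g y :=
    fun j g => integrable_bdd_mul_schwartz ((continuous_regKernel hε j).comp (by fun_prop)).measurable
      (fun y => abs_regKernel_le_const hε j (x - y)) g
  have hK' : ∀ (j k : Fin 3) (g : SchwartzMap E3 ℝ),
      Integrable fun y => regKernelDeriv ε j k (x - y) * g y :=
    fun j k g => integrable_bdd_mul_schwartz
      ((continuous_regKernelDeriv hε j k).comp (by fun_prop)).measurable
      (fun y => abs_regKernelDeriv_le_const hε j k (x - y)) g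
  simp_rw [Finset.mul_sum]
  rw [integral_finsetSum _ fun k _ => hK j _]
  have h : ∀ k, ∫ y, regKernel ε j (x - y) * spd k (spd k w) y =
      ∫ y, regKernelDeriv ε k k (x - y) * spd j w y := by
    intro k
    rw [integral_regKernel_mul_spd hε]
    simp_rw [regKernelDeriv_comm j k]
    rw [← integral_regKernel_mul_spd hε, spd_comm, integral_regKernel_mul_spd hε]
  simp_rw [h]
  rw [← integral_finsetSum _ fun k _ => hK' k k _]
  simp_rw [← Finset.sum_mul, sum_regKernelDeriv hε]

lemma regMollifier_smul (hε : 0 < ε) (z : E3) :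
    ε ^ 3 * regMollifier ε (ε • z) = regMollifier 1 z := by
  have h : regSq ε (ε • z) = ε ^ 2 * regSq 1 z := by
    rw [regSq, regSq, norm_smul, Real.norm_of_nonneg hε.le]; ring
  have h1 : (ε ^ 2) ^ (-(5 / 2) : ℝ) = (ε ^ 5)⁻¹ := by
    rw [← rpow_natCast ε 2, ← rpow_mul hε.le, ← rpow_natCast ε 5, ← rpow_neg hε.le]
    norm_num
  rw [regMollifier, regMollifier, h, mul_rpow (by positivity) (regSq_pos one_pos z).le, h1]
  field_simp

lemma integral_regMollifier_mul (hε : 0 < ε) (x : E3) (u : E3 → ℝ) :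
    ∫ y, regMollifier ε (x - y) * u y = ∫ z, regMollifier 1 z * u (x - ε • z) := by
  have h1 : ∫ y, regMollifier ε (x - y) * u y = ∫ y, regMollifier ε y * u (x - y) := by
    rw [← integral_sub_left_eq_self (fun y => regMollifier ε y * u (x - y)) volume x]
    simp
  have h2 := Measure.integral_comp_smul (volume : Measure E3)
    (fun y => regMollifier ε y * u (x - y)) ε
  rw [finrank_euclideanSpace_fin, abs_of_pos (by positivity), smul_eq_mul] at h2
  have h3 : ∫ y, regMollifier ε y * u (x - y) =
      ε ^ 3 * ∫ z, regMollifier ε (ε • z) * u (x - ε • z) := by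
    rw [h2]; field_simp
  rw [h1, h3, ← integral_const_mul]
  refine integral_congr_ae (Filter.Eventually.of_forall fun z => ?_)
  simp only [← regMollifier_smul hε, mul_assoc]

lemma regMollifier_pos (hε : 0 < ε) (z : E3) : 0 < regMollifier ε z := by
  have := regSq_pos hε z
  unfold regMollifier; positivity

lemma integrable_regMollifier_one : Integrable (regMollifier 1) := by
  have h := integrable_rpow_neg_one_add_norm_sq (E := E3) (μ := volume) (r := 5)
    (by simp; norm_num)
  refine (h.const_mul 3).congr (Filter.Eventually.of_forall fun z => ?_)
  simp only [regMollifier, regSq]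
  rw [one_pow, mul_one, add_comm, neg_div]

lemma integral_regMollifier_one_pos : 0 < ∫ z, regMollifier 1 z := by
  rw [integral_pos_iff_support_of_nonneg (fun z => (regMollifier_pos one_pos z).le)
    integrable_regMollifier_one]
  have : Function.support (regMollifier 1) = Set.univ :=
    Set.eq_univ_of_forall fun z => (regMollifier_pos one_pos z).ne'
  rw [this]
  exact isOpen_univ.measure_pos _ Set.univ_nonempty

lemma tendsto_integral_regMollifier_mul (u : SchwartzMap E3 ℝ) (x : E3) :
    Filter.Tendsto (fun n : ℕ => ∫ y, regMollifier (1 / ((n : ℝ) + 1)) (x - y) * u y) Filter.atTop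
      (nhds ((∫ z, regMollifier 1 z) * u x)) := by
  obtain ⟨M, hM⟩ : ∃ M, ∀ y, ‖u y‖ ≤ M :=
    ⟨_, fun y => by simpa using u.le_seminorm ℝ 0 0 y⟩
  rw [← integral_mul_const]
  have hpos : ∀ n : ℕ, (0 : ℝ) < 1 / ((n : ℝ) + 1) := fun n => by positivity
  simp_rw [fun n : ℕ => integral_regMollifier_mul (hpos n) x u]
  refine tendsto_integral_of_dominated_convergence (fun z => regMollifier 1 z * M) ?_ ?_ ?_ ?_
  · intro n
    exact ((continuous_regMollifier one_pos).mul
      (u.continuous.comp (by fun_prop))).aestronglyMeasurable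
  · exact integrable_regMollifier_one.mul_const M
  · intro n
    refine Filter.Eventually.of_forall fun z => ?_
    rw [norm_mul, Real.norm_of_nonneg (regMollifier_pos one_pos z).le]
    exact mul_le_mul_of_nonneg_left (hM _) (regMollifier_pos one_pos z).le
  · refine Filter.Eventually.of_forall fun z => Filter.Tendsto.const_mul _ ?_
    have h : Filter.Tendsto (fun n : ℕ => x - (1 / ((n : ℝ) + 1)) • z) Filter.atTop
        (nhds (x - (0 : ℝ) • z)) :=
      tendsto_const_nhds.sub (tendsto_one_div_add_atTop_nhds_zero_nat.smul_const z)
    rw [zero_smul, sub_zero] at h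
    exact (u.continuous.tendsto x).comp h

end mollification

section gradient

variable {f : Fin 3 → SchwartzMap E3 ℝ} {i : Fin 3} {w : SchwartzMap E3 ℝ}

lemma lintegral_mul_enorm_spd_le (hdiv : ∀ x, ∑ k, spd k (f k) x = 0)
    (hw : ∀ x, f i x = -∑ k, spd k (spd k w) x) (j : Fin 3) {L : ℝ} (hL : 0 < L)
    (hfL : ∑ k, ∫⁻ y, ‖f k y‖ₑ ≤ ENNReal.ofReal L) {g : E3 → ℝ≥0∞} (hg : Measurable g)
    (hgt : ∀ x, g x ≠ ⊤) :
    ‖∫ z, regMollifier 1 z‖ₑ * ∫⁻ x, g x * ‖spd j w x‖ₑ ≤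
      newtonConst * ENNReal.ofReal L * (∫⁻ x, g x ^ 3) ^ (1 / 3 : ℝ) := by
  have hpos : ∀ n : ℕ, (0 : ℝ) < 1 / ((n : ℝ) + 1) := fun n => by positivity
  have hlim : ∀ x, Filter.Tendsto (fun n : ℕ => g x *
      ‖∫ y, regMollifier (1 / ((n : ℝ) + 1)) (x - y) * spd j w y‖ₑ) Filter.atTop
      (nhds (g x * ‖(∫ z, regMollifier 1 z) * spd j w x‖ₑ)) := fun x =>
    ENNReal.Tendsto.const_mul (tendsto_integral_regMollifier_mul (spd j w) x).enorm
      (Or.inr (hgt x))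
  have hmeas : ∀ n : ℕ, Measurable fun x => g x *
      ‖∫ y, regMollifier (1 / ((n : ℝ) + 1)) (x - y) * spd j w y‖ₑ := by
    intro n
    have h : Measurable fun p : E3 × E3 =>
        regMollifier (1 / ((n : ℝ) + 1)) (p.1 - p.2) * spd j w p.2 :=
      ((continuous_regMollifier (hpos n)).comp (by fun_prop)).measurable.mul
        ((spd j w).continuous.comp continuous_snd).measurable
    exact hg.mul h.stronglyMeasurable.integral_prod_right'.measurable.enorm
  have hbound : ∀ n : ℕ, ∫⁻ x, g x *
      ‖∫ y, regMollifier (1 / ((n : ℝ) + 1)) (x - y) * spd j w y‖ₑ ≤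
      newtonConst * ENNReal.ofReal L * (∫⁻ x, g x ^ 3) ^ (1 / 3 : ℝ) := by
    intro n
    have h := lintegral_mul_enorm_integral_regKernel_le (i := i) (j := j) (hpos n) f hdiv hL hfL hg
    simp_rw [hw, mul_neg, integral_neg, enorm_neg,
      integral_regKernel_mul_laplacian (hpos n)] at h
    exact h
  calc _ = ∫⁻ x, g x * ‖(∫ z, regMollifier 1 z) * spd j w x‖ₑ := by
        have hm : Measurable fun x => g x * ‖spd j w x‖ₑ :=
          hg.mul (spd j w).continuous.enorm.measurable
        rw [← lintegral_const_mul _ hm]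
        refine lintegral_congr fun x => ?_
        rw [enorm_mul]; ring
    _ = ∫⁻ x, Filter.liminf (fun n : ℕ => g x *
          ‖∫ y, regMollifier (1 / ((n : ℝ) + 1)) (x - y) * spd j w y‖ₑ) Filter.atTop :=
        lintegral_congr fun x => (hlim x).liminf_eq.symm
    _ ≤ Filter.liminf (fun n : ℕ => ∫⁻ x, g x *
          ‖∫ y, regMollifier (1 / ((n : ℝ) + 1)) (x - y) * spd j w y‖ₑ) Filter.atTop :=
        lintegral_liminf_le hmeas
    _ ≤ _ := Filter.liminf_le_of_frequently_le' (Filter.Frequently.of_forall hbound)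

/-- The constant in the endpoint gradient estimate for divergence-free right-hand sides. -/
def gradConst : ℝ≥0∞ := ‖∫ z, regMollifier 1 z‖ₑ⁻¹ * newtonConst

lemma gradConst_ne_top : gradConst ≠ ⊤ := by
  refine ENNReal.mul_ne_top (ENNReal.inv_ne_top.2 ?_) newtonConst_ne_top
  simpa using integral_regMollifier_one_pos.ne'

lemma eLpNorm_spd_le_ofReal (hdiv : ∀ x, ∑ k, spd k (f k) x = 0)
    (hw : ∀ x, f i x = -∑ k, spd k (spd k w) x) (j : Fin 3) {L : ℝ} (hL : 0 < L)
    (hfL : ∑ k, ∫⁻ y, ‖f k y‖ₑ ≤ ENNReal.ofReal L) :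
    eLpNorm (spd j w) (3 / 2) volume ≤ gradConst * ENNReal.ofReal L := by
  have hp0 : (3 / 2 : ℝ≥0∞) ≠ 0 := by simp
  have hpt : (3 / 2 : ℝ≥0∞) ≠ ⊤ := ENNReal.div_ne_top (by simp) (by simp)
  have hpr : (3 / 2 : ℝ≥0∞).toReal = 3 / 2 := by simp
  have hfin := ((spd j w).memLp (3 / 2) volume).2
  rw [eLpNorm_eq_lintegral_rpow_enorm_toReal hp0 hpt, hpr] at hfin ⊢
  have h := lintegral_mul_enorm_spd_le hdiv hw j hL hfL
    (g := fun x => ‖spd j w x‖ₑ ^ (1 / 2 : ℝ))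
    ((spd j w).continuous.enorm.measurable.pow_const _)
    (fun x => ENNReal.rpow_ne_top_of_nonneg (by norm_num) enorm_ne_top)
  have h1 : ∀ x, ‖spd j w x‖ₑ ^ (1 / 2 : ℝ) * ‖spd j w x‖ₑ = ‖spd j w x‖ₑ ^ (3 / 2 : ℝ) := by
    intro x
    nth_rewrite 2 [← ENNReal.rpow_one ‖spd j w x‖ₑ]
    rw [← ENNReal.rpow_add_of_nonneg _ _ (by norm_num) (by norm_num)]
    norm_num
  have h2 : ∀ x, (‖spd j w x‖ₑ ^ (1 / 2 : ℝ)) ^ 3 = ‖spd j w x‖ₑ ^ (3 / 2 : ℝ) := by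
    intro x
    rw [← ENNReal.rpow_natCast, ← ENNReal.rpow_mul]
    norm_num
  simp_rw [h1, h2] at h
  set I := ∫⁻ x, ‖spd j w x‖ₑ ^ (3 / 2 : ℝ)
  have hIt : I ≠ ⊤ := by
    intro hI
    rw [hI, ENNReal.top_rpow_of_pos (by norm_num)] at hfin
    exact lt_irrefl _ hfin
  rcases eq_or_ne I 0 with h0 | h0
  · rw [h0, ENNReal.zero_rpow_of_pos (by norm_num)]; exact zero_le
  have hI : I = I ^ (1 / (3 / 2) : ℝ) * I ^ (1 / 3 : ℝ) := by
    rw [← ENNReal.rpow_add _ _ h0 hIt]; norm_num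
  have hI3 : I ^ (1 / 3 : ℝ) ≠ 0 := by simp [h0]
  have hI3t : I ^ (1 / 3 : ℝ) ≠ ⊤ := ENNReal.rpow_ne_top_of_nonneg (by norm_num) hIt
  nth_rewrite 1 [hI] at h
  rw [← mul_assoc, ENNReal.mul_le_mul_iff_left hI3 hI3t] at h
  have hm : ‖∫ z, regMollifier 1 z‖ₑ ≠ 0 := by simpa using integral_regMollifier_one_pos.ne'
  rw [gradConst, mul_assoc]
  rwa [← ENNReal.inv_mul_le_iff (by simp) (by simpa using integral_regMollifier_one_pos.ne'), inv_inv]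

lemma eLpNorm_spd_le (hdiv : ∀ x, ∑ k, spd k (f k) x = 0)
    (hw : ∀ x, f i x = -∑ k, spd k (spd k w) x) (j : Fin 3) :
    eLpNorm (spd j w) (3 / 2) volume ≤ gradConst * ∑ k, ∫⁻ y, ‖f k y‖ₑ := by
  have hS : ∑ k, ∫⁻ y, ‖f k y‖ₑ ≠ ⊤ :=
    ENNReal.sum_ne_top.2 fun k _ => (f k).integrable.2.ne
  have hcont : Filter.Tendsto (fun δ : ℝ => gradConst *
      ENNReal.ofReal ((∑ k, ∫⁻ y, ‖f k y‖ₑ).toReal + δ)) (nhdsWithin 0 (Set.Ioi 0))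
      (nhds (gradConst * ENNReal.ofReal ((∑ k, ∫⁻ y, ‖f k y‖ₑ).toReal + 0))) := by
    refine ENNReal.Tendsto.const_mul ?_ (Or.inr gradConst_ne_top)
    have : Continuous fun δ : ℝ => ENNReal.ofReal ((∑ k, ∫⁻ y, ‖f k y‖ₑ).toReal + δ) :=
      ENNReal.continuous_ofReal.comp (by fun_prop)
    exact (this.tendsto 0).mono_left nhdsWithin_le_nhds
  rw [add_zero, ENNReal.ofReal_toReal hS] at hcont
  refine ge_of_tendsto hcont ?_
  filter_upwards [self_mem_nhdsWithin] with δ hδ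
  have hδ' : 0 < δ := hδ
  refine eLpNorm_spd_le_ofReal hdiv hw j (by positivity) ?_
  calc _ = ENNReal.ofReal (∑ k, ∫⁻ y, ‖f k y‖ₑ).toReal := (ENNReal.ofReal_toReal hS).symm
    _ ≤ _ := ENNReal.ofReal_le_ofReal (by linarith)

end gradient

section sobolev

/-- A smooth cutoff function equal to one near the origin. -/
def cutoff : ContDiffBump (0 : E3) := ⟨1, 2, one_pos, one_lt_two⟩

lemma exists_norm_fderiv_cutoff_le : ∃ B, ∀ x, ‖fderiv ℝ cutoff x‖ ≤ B := by
  have h : Continuous (fderiv ℝ cutoff) := cutoff.contDiff.continuous_fderiv (n := 1) (by simp)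
  exact h.bounded_above_of_compact_support (cutoff.hasCompactSupport.fderiv ℝ)

lemma norm_fderiv_cutoff_smul_le {B : ℝ} (hB : ∀ x, ‖fderiv ℝ cutoff x‖ ≤ B) {δ : ℝ} (hδ : 0 < δ)
    (v : SchwartzMap E3 E3) (x : E3) :
    ‖fderiv ℝ (fun x => cutoff (δ • x) • v x) x‖ ≤ ‖fderiv ℝ v x‖ + δ * B * ‖v x‖ := by
  have h1 : HasFDerivAt (fun x => cutoff (δ • x))
      ((fderiv ℝ cutoff (δ • x)).comp (δ • ContinuousLinearMap.id ℝ E3)) x :=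
    ((cutoff.contDiff (n := 1)).differentiable (by simp) _).hasFDerivAt.comp x
      ((hasFDerivAt_id x).const_smul δ)
  rw [(h1.fun_smul v.differentiableAt.hasFDerivAt).fderiv]
  refine (norm_add_le _ _).trans (add_le_add ?_ ?_)
  · rw [norm_smul]
    refine mul_le_of_le_one_left (norm_nonneg _) ?_
    rw [Real.norm_of_nonneg cutoff.nonneg]
    exact cutoff.le_one
  · rw [ContinuousLinearMap.norm_smulRight_apply]
    gcongr
    refine (ContinuousLinearMap.opNorm_comp_le _ _).trans ?_
    rw [norm_smul, Real.norm_of_nonneg hδ.le, mul_comm]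
    have h2 : ‖ContinuousLinearMap.id ℝ E3‖ ≤ 1 := ContinuousLinearMap.norm_id_le
    calc _ ≤ δ * 1 * B := by gcongr; exact hB _
      _ = _ := by ring

lemma eLpNorm_cutoff_smul_le {δ : ℝ} (hδ : 0 < δ) (v : SchwartzMap E3 E3) :
    eLpNorm (fun x => cutoff (δ • x) • v x) 3 volume ≤
      SNormLESNormFDerivOfEqConst E3 (volume : Measure E3) (3 / 2 : ℝ) *
        eLpNorm (fderiv ℝ fun x => cutoff (δ • x) • v x) (3 / 2) volume := by
  have h1 : ContDiff ℝ 1 fun x => cutoff (δ • x) • v x :=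
    ((cutoff.contDiff (n := 1)).comp (contDiff_const_smul δ)).smul (v.smooth 1)
  have h2 : HasCompactSupport fun x => cutoff (δ • x) • v x := by
    have : HasCompactSupport fun x : E3 => cutoff (δ • x) :=
      cutoff.hasCompactSupport.comp_homeomorph (Homeomorph.smulOfNeZero δ hδ.ne')
    exact this.smul_right
  have h := eLpNorm_le_eLpNorm_fderiv_of_eq (μ := volume) (F := E3) h1 h2 (p := 3 / 2) (p' := 3)
    (by rw [← NNReal.coe_le_coe]; norm_num) (by simp) (by simp; norm_num)
  have e : ((3 / 2 : NNReal) : ℝ≥0∞) = 3 / 2 := by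
    rw [ENNReal.coe_div (by norm_num)]; simp
  rw [e] at h
  simpa using h

/-- The constant in the Sobolev inequality `L³ ← W^{1,3/2}` on `ℝ³`. -/
def sobolevConst : ℝ≥0∞ := SNormLESNormFDerivOfEqConst E3 (volume : Measure E3) (3 / 2 : ℝ)

lemma one_le_three_halves : (1 : ℝ≥0∞) ≤ 3 / 2 := by
  rw [ENNReal.le_div_iff_mul_le (by simp) (by simp)]; norm_num

lemma eLpNorm_three_le_fderiv (v : SchwartzMap E3 E3) :
    eLpNorm v 3 volume ≤ sobolevConst * eLpNorm (fderiv ℝ v) (3 / 2) volume := by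
  obtain ⟨B, hB⟩ := exists_norm_fderiv_cutoff_le
  have hB0 : 0 ≤ B := (norm_nonneg _).trans (hB 0)
  set δ : ℕ → ℝ := fun n => 1 / ((n : ℝ) + 1) with hδ
  have hpos : ∀ n, 0 < δ n := fun n => by positivity
  have hδ0 : Filter.Tendsto δ Filter.atTop (nhds 0) := tendsto_one_div_add_atTop_nhds_zero_nat
  have hv1 : AEStronglyMeasurable (fun x => ‖fderiv ℝ v x‖) volume :=
    ((v.smooth 1).continuous_fderiv (by simp)).norm.aestronglyMeasurable
  have hv2 : ∀ n, AEStronglyMeasurable (fun x => (δ n * B) • ‖v x‖) volume := by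
    intro n
    have h : Continuous fun x => (δ n * B) • ‖v x‖ := by fun_prop
    exact h.aestronglyMeasurable
  have hbound : ∀ n, eLpNorm (fun x => cutoff (δ n • x) • v x) 3 volume ≤
      sobolevConst * (eLpNorm (fderiv ℝ v) (3 / 2) volume +
        ENNReal.ofReal (δ n * B) * eLpNorm v (3 / 2) volume) := by
    intro n
    refine (eLpNorm_cutoff_smul_le (hpos n) v).trans ?_
    unfold sobolevConst
    gcongr
    have hc : 0 ≤ δ n * B := mul_nonneg (hpos n).le hB0
    calc _ ≤ eLpNorm (fun x => ‖fderiv ℝ v x‖ + (δ n * B) • ‖v x‖) (3 / 2) volume :=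
          eLpNorm_mono_real fun x => norm_fderiv_cutoff_smul_le hB (hpos n) v x
      _ ≤ eLpNorm (fun x => ‖fderiv ℝ v x‖) (3 / 2) volume +
          eLpNorm (fun x => (δ n * B) • ‖v x‖) (3 / 2) volume :=
          eLpNorm_add_le hv1 (hv2 n) one_le_three_halves
      _ = _ := by
          have := eLpNorm_const_smul (δ n * B) (fun x => ‖v x‖) (3 / 2) (volume : Measure E3)
          rw [show (fun x => (δ n * B) • ‖v x‖) = (δ n * B) • fun x => ‖v x‖ from rfl, this,
            eLpNorm_norm, eLpNorm_norm, Real.enorm_of_nonneg hc]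
  have hM : eLpNorm v (3 / 2) volume ≠ ⊤ := (v.memLp (3 / 2) volume).2.ne
  have hlim : Filter.Tendsto (fun n => sobolevConst * (eLpNorm (fderiv ℝ v) (3 / 2) volume +
      ENNReal.ofReal (δ n * B) * eLpNorm v (3 / 2) volume)) Filter.atTop
      (nhds (sobolevConst * (eLpNorm (fderiv ℝ v) (3 / 2) volume +
        ENNReal.ofReal (0 * B) * eLpNorm v (3 / 2) volume))) := by
    refine ENNReal.Tendsto.const_mul (tendsto_const_nhds.add ?_) (Or.inr ENNReal.coe_ne_top)
    exact ENNReal.Tendsto.mul_const (ENNReal.tendsto_ofReal (hδ0.mul_const B)) (Or.inr hM)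
  rw [zero_mul, ENNReal.ofReal_zero, zero_mul, add_zero] at hlim
  have hFatou := Lp.eLpNorm_lim_le_liminf_eLpNorm (p := 3) (μ := (volume : Measure E3))
    (f := fun n x => cutoff (δ n • x) • v x)
    (fun n => ((cutoff.continuous.comp (continuous_const_smul (δ n))).smul
      v.continuous).aestronglyMeasurable) v
    (Filter.Eventually.of_forall fun x => by
      have h1 : Filter.Tendsto (fun n => cutoff (δ n • x)) Filter.atTop (nhds (cutoff 0)) := by
        refine (cutoff.continuous.tendsto 0).comp ?_
        simpa using hδ0.smul_const x
      have h2 : cutoff (0 : E3) = 1 :=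
        cutoff.one_of_mem_closedBall (Metric.mem_closedBall_self cutoff.rIn_pos.le)
      rw [h2] at h1
      simpa using h1.smul_const (v x))
  exact hFatou.trans ((Filter.liminf_le_liminf (Filter.Eventually.of_forall hbound)).trans
    hlim.liminf_eq.le)

end sobolev

section components

/-- A component of a Schwartz vector field. -/
def comp (v : SchwartzMap E3 E3) (i : Fin 3) : SchwartzMap E3 ℝ :=
  SchwartzMap.postcompCLM (EuclideanSpace.proj i : E3 →L[ℝ] ℝ) v

lemma fderiv_coord {g : E3 → E3} {x : E3} (hg : DifferentiableAt ℝ g x) (m : E3) (i : Fin 3) :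
    fderiv ℝ (fun y => g y i) x m = fderiv ℝ g x m i := by
  have h := ((EuclideanSpace.proj i : E3 →L[ℝ] ℝ).hasFDerivAt (x := g x)).comp x hg.hasFDerivAt
  have h2 : HasFDerivAt (fun y => g y i)
    ((EuclideanSpace.proj i : E3 →L[ℝ] ℝ).comp (fderiv ℝ g x)) x := h
  rw [h2.fderiv]
  rfl

lemma spd_comp (v : SchwartzMap E3 E3) (i k : Fin 3) (x : E3) :
    spd k (comp v i) x = fderiv ℝ v x (EuclideanSpace.single k 1) i := by
  rw [spd_apply, ← fderiv_coord v.differentiableAt]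
  rfl

lemma spd_sub (k : Fin 3) (f g : SchwartzMap E3 ℝ) : spd k (f - g) = spd k f - spd k g := by
  ext x
  have h : HasFDerivAt (fun x => f x - g x) (fderiv ℝ f x - fderiv ℝ g x) x :=
    f.differentiableAt.hasFDerivAt.sub g.differentiableAt.hasFDerivAt
  rw [sub_apply, spd_apply, spd_apply, spd_apply,
    show ⇑(f - g) = fun x => f x - g x from rfl, h.fderiv]
  rfl

lemma lap_coord (v : SchwartzMap E3 E3) (i : Fin 3) (x : E3) :
    lap v x i = ∑ k, spd k (spd k (comp v i)) x := by
  have hd : DifferentiableAt ℝ (fderiv ℝ v) x :=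
    ((v.smooth 2).fderiv_right (m := 1) (by norm_num)).differentiable (by norm_num) x
  rw [lap, WithLp.ofLp_sum, Finset.sum_apply]
  refine Finset.sum_congr rfl fun k _ => ?_
  rw [← fderiv_coord (hd.clm_apply (differentiableAt_const _)), spd_apply,
    show ⇑(spd k (comp v i)) = fun y => fderiv ℝ v y (EuclideanSpace.single k 1) i from
      funext fun y => spd_comp v i k y]

/-- The components of the curl of a Schwartz vector field, as Schwartz functions. -/
def curlComp (ω : SchwartzMap E3 E3) : Fin 3 → SchwartzMap E3 ℝ :=
  ![spd 1 (comp ω 2) - spd 2 (comp ω 1), spd 2 (comp ω 0) - spd 0 (comp ω 2),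
    spd 0 (comp ω 1) - spd 1 (comp ω 0)]

lemma curlComp_apply (ω : SchwartzMap E3 E3) (i : Fin 3) (x : E3) :
    curlComp ω i x = curl ω x i := by
  fin_cases i <;> simp [curlComp, curl, coe_spd] <;> rfl

lemma sum_spd_curlComp (ω : SchwartzMap E3 E3) (x : E3) :
    ∑ k, spd k (curlComp ω k) x = 0 := by
  simp only [Fin.sum_univ_three, curlComp, Matrix.cons_val, spd_sub, sub_apply]
  rw [spd_comm 1 0, spd_comm 2 0, spd_comm 2 1]
  ring

lemma sum_lintegral_enorm_curlComp_le (ω : SchwartzMap E3 E3) :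
    ∑ k, ∫⁻ y, ‖curlComp ω k y‖ₑ ≤ 3 * eLpNorm (curl ω) 1 volume := by
  have h : ∀ k, ∫⁻ y, ‖curlComp ω k y‖ₑ ≤ eLpNorm (curl ω) 1 volume := by
    intro k
    rw [eLpNorm_one_eq_lintegral_enorm]
    refine lintegral_mono fun y => ?_
    rw [curlComp_apply, enorm_le_iff_norm_le]
    exact PiLp.norm_apply_le _ _
  refine (Finset.sum_le_sum fun k _ => h k).trans ?_
  simp

lemma norm_fderiv_le_sum (v : SchwartzMap E3 E3) (x : E3) :
    ‖fderiv ℝ v x‖ ≤ ∑ j, ∑ i, ‖spd j (comp v i) x‖ := by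
  have hE : ∀ z : E3, ‖z‖ ≤ ∑ i, ‖z i‖ := by
    intro z
    conv_lhs => rw [← (EuclideanSpace.basisFun (Fin 3) ℝ).sum_repr z]
    refine (norm_sum_le _ _).trans (Finset.sum_le_sum fun i _ => ?_)
    simp [norm_smul]
  refine ContinuousLinearMap.opNorm_le_bound _ (by positivity) fun m => ?_
  have hm : fderiv ℝ v x m = ∑ j, m j • fderiv ℝ v x (EuclideanSpace.single j 1) := by
    conv_lhs => rw [← (EuclideanSpace.basisFun (Fin 3) ℝ).sum_repr m]
    simp
  rw [hm, Finset.sum_mul]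
  refine (norm_sum_le _ _).trans (Finset.sum_le_sum fun j _ => ?_)
  rw [norm_smul, mul_comm]
  refine mul_le_mul ?_ (PiLp.norm_apply_le m j) (norm_nonneg _) (by positivity)
  simp_rw [spd_comp]
  exact hE _

lemma eLpNorm_fderiv_le_sum (v : SchwartzMap E3 E3) :
    eLpNorm (fderiv ℝ v) (3 / 2) volume ≤
      ∑ j, ∑ i, eLpNorm (spd j (comp v i)) (3 / 2) volume := by
  have hs : ∀ j i, AEStronglyMeasurable (fun x => ‖spd j (comp v i) x‖) volume :=
    fun j i => (spd j (comp v i)).continuous.norm.aestronglyMeasurable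
  calc _ ≤ eLpNorm (fun x => ∑ j, ∑ i, ‖spd j (comp v i) x‖) (3 / 2) volume :=
        eLpNorm_mono_real (norm_fderiv_le_sum v)
    _ = eLpNorm (∑ p : Fin 3 × Fin 3, fun x => ‖spd p.1 (comp v p.2) x‖) (3 / 2) volume := by
        congr 1
        ext x
        rw [Finset.sum_apply, Fintype.sum_prod_type]
    _ ≤ ∑ p : Fin 3 × Fin 3, eLpNorm (fun x => ‖spd p.1 (comp v p.2) x‖) (3 / 2) volume :=
        eLpNorm_sum_le (fun p _ => hs p.1 p.2) one_le_three_halves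
    _ = _ := by
        rw [Fintype.sum_prod_type]
        simp_rw [eLpNorm_norm]

lemma eLpNorm_fderiv_le_curl {ω v : SchwartzMap E3 E3} (h : ∀ x, -(lap v x) = curl ω x) :
    eLpNorm (fderiv ℝ v) (3 / 2) volume ≤ 27 * gradConst * eLpNorm (curl ω) 1 volume := by
  have hw : ∀ i x, curlComp ω i x = -∑ k, spd k (spd k (comp v i)) x := by
    intro i x
    rw [curlComp_apply, ← h, PiLp.neg_apply, lap_coord]
  have h1 : ∀ j i, eLpNorm (spd j (comp v i)) (3 / 2) volume ≤
      gradConst * (3 * eLpNorm (curl ω) 1 volume) := fun j i =>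
    (eLpNorm_spd_le (sum_spd_curlComp ω) (hw i) j).trans
      (by gcongr; exact sum_lintegral_enorm_curlComp_le ω)
  refine (eLpNorm_fderiv_le_sum v).trans
    ((Finset.sum_le_sum fun j _ => Finset.sum_le_sum fun i _ => h1 j i).trans (le_of_eq ?_))
  simp only [Finset.sum_const, Finset.card_univ, Fintype.card_fin, nsmul_eq_mul]
  push_cast
  ring

end components

/-- **Uniform-in-time 3D Bourgain–Brezis estimate (end of Section 1).** There
is a universal constant `C > 0` such that for any time-dependent vector fields
`ω, v` on `ℝ³`, Schwartz in space at each time `t > 0` and satisfying the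
Biot–Savart relation `−Δv(·,t) = ∇ × ω(·,t)`, one has
`sup_{t>0} ‖v(·,t)‖_{L³} + sup_{t>0} ‖∇v(·,t)‖_{L^{3/2}}
  ≤ C sup_{t>0} ‖∇ × ω(·,t)‖_{L¹}`. -/
theorem bourgain_brezis_biot_savart_3d_uniform_in_time :
    ∃ C : ℝ, 0 < C ∧
      ∀ (ω v : ℝ → SchwartzMap E3 E3),
        (∀ t : ℝ, 0 < t → ∀ x : E3, -(lap (⇑(v t)) x) = curl (⇑(ω t)) x) →
        (⨆ (t : ℝ) (_ : 0 < t), eLpNorm (⇑(v t)) 3 volume) +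
            (⨆ (t : ℝ) (_ : 0 < t), eLpNorm (fun x => fderiv ℝ (⇑(v t)) x) (3/2) volume) ≤
          ENNReal.ofReal C * ⨆ (t : ℝ) (_ : 0 < t), eLpNorm (curl (⇑(ω t))) 1 volume := by
  set K : ℝ≥0∞ := 27 * gradConst with hK
  have hKt : sobolevConst * K + K ≠ ⊤ := by
    have : K ≠ ⊤ := ENNReal.mul_ne_top (by simp) gradConst_ne_top
    exact ENNReal.add_ne_top.2 ⟨ENNReal.mul_ne_top ENNReal.coe_ne_top this, this⟩
  refine ⟨(sobolevConst * K + K).toReal + 1, by positivity, fun ω v h => ?_⟩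
  set S := ⨆ (t : ℝ) (_ : 0 < t), eLpNorm (curl (⇑(ω t))) 1 volume with hS
  have hgrad : ∀ t, 0 < t → eLpNorm (fderiv ℝ (v t)) (3 / 2) volume ≤ K * S := by
    intro t ht
    refine (eLpNorm_fderiv_le_curl (h t ht)).trans ?_
    gcongr
    exact le_iSup₂ (f := fun (t : ℝ) (_ : 0 < t) => eLpNorm (curl (⇑(ω t))) 1 volume) t ht
  have hvel : ∀ t, 0 < t → eLpNorm (v t) 3 volume ≤ sobolevConst * K * S := by
    intro t ht
    rw [mul_assoc]
    refine (eLpNorm_three_le_fderiv (v t)).trans ?_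
    gcongr
    exact hgrad t ht
  calc _ ≤ sobolevConst * K * S + K * S := add_le_add (iSup₂_le hvel) (iSup₂_le hgrad)
    _ = (sobolevConst * K + K) * S := (add_mul _ _ _).symm
    _ ≤ _ := by
      gcongr
      calc _ = ENNReal.ofReal (sobolevConst * K + K).toReal := (ENNReal.ofReal_toReal hKt).symm
        _ ≤ _ := ENNReal.ofReal_le_ofReal (by linarith)

end
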